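/- (Euclidean Annulus Lemma.) Let R > 0, L ≥ 0, and let r_i ∈ (0, R) be a sequence with r_i → 0. For each i let u_i be a function on the closed annulus A(r_i, R) = {p ∈ ℝ² : r_i ≤ ‖p‖ ≤ R}, continuous on A(r_i, R), smooth on the open annulus and satisfying the minimal surface equation there, with ‖∇u_i‖ ≤ L throughout, with u_i(q) = 0 whenever ‖q‖ = R, and with u_i → 0 uniformly on A(η, R) for every η ∈ (0, R). Let λ_i → ∞ be such that the limit r' = lim_i λ_i·r_i exists and is finite, and let v_i be real numbers such that sup_i (dist((0,0,v_i), graph(u_i)) / r_i) < ∞, where the distance is Euclidean distance in ℝ³ to the graph {(p, u_i(p)) : p ∈ A(r_i, R)}. Define u_i'(q) = λ_i·(u_i(q/λ_i) − v_i) for q ∈ A(λ_i·r_i, λ_i·R). Then there exist a strictly increasing sequence of indices and a smooth function u' on {q ∈ ℝ² : ‖q‖ > r'} satisfying the minimal surface equation there, such that along the subsequence u_i' converges to u' uniformly on every compact subset of {q : ‖q‖ > r'} (each such compact set being contained in the domain of u_i' for all sufficiently large i), and ‖∇u'(q)‖ → 0 as ‖q‖ → ∞. -/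

import Mathlib

open Filter

noncomputable section

/-- The partial derivative `∂ᵢ u` of a function `u : ℝ² → ℝ`. -/
noncomputable def pderiv2 (u : EuclideanSpace ℝ (Fin 2) → ℝ) (i : Fin 2)
    (x : EuclideanSpace ℝ (Fin 2)) : ℝ :=
  fderiv ℝ u x (EuclideanSpace.single i 1)

/-- `u` satisfies the minimal surface equation on `U`: it is `C²` on `U` and
`(1 + (∂₂u)²)∂₁₁u − 2 ∂₁u ∂₂u ∂₁₂u + (1 + (∂₁u)²)∂₂₂u = 0` on `U`. -/
def MinimalSurfaceEquation (u : EuclideanSpace ℝ (Fin 2) → ℝ)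
    (U : Set (EuclideanSpace ℝ (Fin 2))) : Prop :=
  ContDiffOn ℝ 2 u U ∧ ∀ x ∈ U,
    (1 + (pderiv2 u 1 x) ^ 2) * pderiv2 (pderiv2 u 0) 0 x
      - 2 * pderiv2 u 0 x * pderiv2 u 1 x * pderiv2 (pderiv2 u 1) 0 x
      + (1 + (pderiv2 u 0 x) ^ 2) * pderiv2 (pderiv2 u 1) 1 x = 0

/-- The point `(a, b, c)` of Euclidean `ℝ³`. -/
noncomputable def eucl3 (a b c : ℝ) : EuclideanSpace ℝ (Fin 3) :=
  (WithLp.equiv 2 (Fin 3 → ℝ)).symm ![a, b, c]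


section
open Set Metric Topology ComplexConjugate
open scoped ContDiff

/-- The minimal surface equation at a point, for functions on `ℂ`. -/
def MSEAt (f : ℂ → ℝ) (z : ℂ) : Prop :=
  (1 + (fderiv ℝ f z Complex.I) ^ 2) * fderiv ℝ (fderiv ℝ f) z 1 1
    - 2 * fderiv ℝ f z 1 * fderiv ℝ f z Complex.I * fderiv ℝ (fderiv ℝ f) z 1 Complex.I
    + (1 + (fderiv ℝ f z 1) ^ 2) * fderiv ℝ (fderiv ℝ f) z Complex.I Complex.I = 0

/-- `f` is smooth at `z` and satisfies the minimal surface equation there. -/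
def SmoothMSEAt (f : ℂ → ℝ) (z : ℂ) : Prop :=
  ContDiffAt ℝ ∞ f z ∧ MSEAt f z

/-- The area density `√(1 + p² + q²)` of a graph with slopes `p`, `q`. -/
def areaDensity (p q : ℝ) : ℝ := √(1 + p ^ 2 + q ^ 2)

lemma areaDensity_sq (p q : ℝ) : areaDensity p q ^ 2 = 1 + p ^ 2 + q ^ 2 :=
  Real.sq_sqrt (by positivity)

lemma one_le_areaDensity (p q : ℝ) : 1 ≤ areaDensity p q :=
  Real.one_le_sqrt.2 (by nlinarith [sq_nonneg p, sq_nonneg q])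

lemma areaDensity_pos (p q : ℝ) : 0 < areaDensity p q :=
  lt_of_lt_of_le one_pos (one_le_areaDensity p q)

/-- The real-linear functional `v ↦ Re (g v)`. -/
def reMul (g : ℂ) : ℂ →L[ℝ] ℝ := Complex.reCLM.comp (ContinuousLinearMap.mul ℝ ℂ g)

@[simp] lemma reMul_apply (g v : ℂ) : reMul g v = (g * v).re := rfl

/-- The derivative `v ↦ (v - conj (g² v)) / 2` of the horizontal projection in isothermal
coordinates. -/
def chartDeriv (g : ℂ) : ℂ →L[ℝ] ℂ :=
  (1 / 2 : ℝ) • (ContinuousLinearMap.id ℝ ℂ -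
    (Complex.conjCLE : ℂ →L[ℝ] ℂ).comp (ContinuousLinearMap.mul ℝ ℂ (g ^ 2)))

@[simp] lemma chartDeriv_apply (g v : ℂ) : chartDeriv g v = (v - conj (g ^ 2 * v)) / 2 := by
  simp [chartDeriv]; ring

/-- The derivative of the isothermal coordinate, inverse to `chartDeriv g`. -/
def chartDerivInv (g : ℂ) : ℂ →L[ℝ] ℂ :=
  (2 / (1 - ‖g‖ ^ 4) : ℝ) • (ContinuousLinearMap.id ℝ ℂ +
    (Complex.conjCLE : ℂ →L[ℝ] ℂ).comp (ContinuousLinearMap.mul ℝ ℂ (g ^ 2)))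

@[simp] lemma chartDerivInv_apply (g v : ℂ) :
    chartDerivInv g v = (2 / (1 - ‖g‖ ^ 4) : ℝ) * (v + conj (g ^ 2 * v)) := by
  simp [chartDerivInv, mul_add]

lemma one_sub_norm_pow_four_pos {g : ℂ} (hg : ‖g‖ < 1) : 0 < 1 - ‖g‖ ^ 4 :=
  sub_pos.2 (pow_lt_one₀ (norm_nonneg _) hg (by norm_num))

lemma conj_sq_mul_sq (g : ℂ) : conj (g ^ 2) * g ^ 2 = ((‖g‖ ^ 4 : ℝ) : ℂ) := by
  have h : conj g * g = ((‖g‖ ^ 2 : ℝ) : ℂ) := by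
    rw [← Complex.normSq_eq_norm_sq, Complex.normSq_eq_conj_mul_self]
  rw [map_pow, ← mul_pow, h]; push_cast; ring

/-- `chartDeriv g` as an invertible map, for `‖g‖ < 1`. -/
def chartEquiv (g : ℂ) (hg : ‖g‖ < 1) : ℂ ≃L[ℝ] ℂ :=
  ContinuousLinearEquiv.equivOfInverse (chartDeriv g) (chartDerivInv g)
    (fun v => by
      have h1 : ((1 - ‖g‖ ^ 4 : ℝ) : ℂ) ≠ 0 :=
        Complex.ofReal_ne_zero.2 (one_sub_norm_pow_four_pos hg).ne'
      have h2 := conj_sq_mul_sq g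
      simp only [chartDerivInv_apply, chartDeriv_apply]
      push_cast at h1 h2 ⊢
      simp only [map_mul, map_div₀, map_sub, Complex.conj_conj, map_ofNat, map_pow] at h2 ⊢
      field_simp
      linear_combination -v * h2)
    (fun v => by
      have h1 : ((1 - ‖g‖ ^ 4 : ℝ) : ℂ) ≠ 0 :=
        Complex.ofReal_ne_zero.2 (one_sub_norm_pow_four_pos hg).ne'
      have h2 := conj_sq_mul_sq g
      simp only [chartDerivInv_apply, chartDeriv_apply]
      push_cast at h1 h2 ⊢
      simp only [map_mul, map_div₀, map_sub, map_add, Complex.conj_conj, map_ofNat, map_pow,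
        Complex.conj_ofReal, map_one] at h2 ⊢
      field_simp
      linear_combination -v * h2)

@[simp] lemma chartEquiv_coe (g : ℂ) (hg : ‖g‖ < 1) :
    (chartEquiv g hg : ℂ →L[ℝ] ℂ) = chartDeriv g := rfl

@[simp] lemma chartEquiv_symm_coe (g : ℂ) (hg : ‖g‖ < 1) :
    ((chartEquiv g hg).symm : ℂ →L[ℝ] ℂ) = chartDerivInv g := rfl

/-- The Gauss map `(p - i q) / (1 + W)` of a graph with slopes `p`, `q`. -/
def gaussMap (p q : ℝ) : ℂ := ⟨p / (1 + areaDensity p q), -q / (1 + areaDensity p q)⟩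

lemma normSq_gaussMap (p q : ℝ) :
    ‖gaussMap p q‖ ^ 2 = (areaDensity p q - 1) / (areaDensity p q + 1) := by
  have hW := areaDensity_sq p q
  have h1 := areaDensity_pos p q
  rw [← Complex.normSq_eq_norm_sq, gaussMap, Complex.normSq_mk]
  field_simp
  linear_combination -(areaDensity p q + 1) * hW

lemma norm_gaussMap_le {p q L : ℝ} (h : p ^ 2 + q ^ 2 ≤ L ^ 2) (hL : 0 ≤ L) :
    ‖gaussMap p q‖ ≤ L / (1 + L) := by
  have hW := areaDensity_sq p q
  have h1 := areaDensity_pos p q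
  have h3 := one_le_areaDensity p q
  have h2 : areaDensity p q * (1 + 2 * L) ≤ 2 * L ^ 2 + 2 * L + 1 := by
    refine (pow_le_pow_iff_left₀ (by positivity) (by positivity) two_ne_zero).1 ?_
    rw [mul_pow, hW]
    nlinarith [mul_le_mul_of_nonneg_right h (sq_nonneg (1 + 2 * L)), pow_nonneg hL 3, sq_nonneg L]
  refine (pow_le_pow_iff_left₀ (by positivity) (by positivity) two_ne_zero).1 ?_
  rw [normSq_gaussMap, div_pow, div_le_div_iff₀ (by positivity) (by positivity)]
  nlinarith

lemma slopes_eq (p q : ℝ) :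
    (⟨p, -q⟩ : ℂ) = 2 * gaussMap p q / (1 - ‖gaussMap p q‖ ^ 2 : ℝ) := by
  have h1 := areaDensity_pos p q
  rw [normSq_gaussMap]
  have : (1 - (areaDensity p q - 1) / (areaDensity p q + 1)) = 2 / (areaDensity p q + 1) := by
    field_simp; ring
  rw [this]
  apply Complex.ext
  · rw [Complex.div_ofReal_re]
    simp [gaussMap]
    field_simp; ring
  · rw [Complex.div_ofReal_im]
    simp [gaussMap]
    field_simp; ring

lemma hasFDerivAt_areaDensity {p q : ℂ → ℝ} {p' q' : ℂ →L[ℝ] ℝ} {z : ℂ}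
    (hp : HasFDerivAt p p' z) (hq : HasFDerivAt q q' z) :
    ∃ W' : ℂ →L[ℝ] ℝ, HasFDerivAt (fun z => areaDensity (p z) (q z)) W' z ∧
      ∀ v, W' v = (p z * p' v + q z * q' v) / areaDensity (p z) (q z) := by
  have h : HasFDerivAt (fun z => 1 + p z ^ 2 + q z ^ 2) (((2 * p z) • p') + (2 * q z) • q') z := by
    refine HasFDerivAt.congr_fderiv (((hp.pow 2).const_add 1).add (hq.pow 2)) ?_
    ext v; simp
  refine ⟨_, h.sqrt (by positivity), fun v => ?_⟩
  have := areaDensity_pos (p z) (q z)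
  simp only [areaDensity] at this ⊢
  simp
  field_simp

/-- The real-linear map with symmetric matrix `((a, b), (b, d))`. -/
def symmMap (a b d : ℝ) : ℂ →L[ℝ] ℂ :=
  a • (Complex.ofRealCLM.comp Complex.reCLM) +
  b • (Complex.ofRealCLM.comp Complex.imCLM + Complex.I • Complex.ofRealCLM.comp Complex.reCLM) +
  d • (Complex.I • Complex.ofRealCLM.comp Complex.imCLM)

lemma symmMap_apply (a b d : ℝ) (v : ℂ) :
    symmMap a b d v = ⟨a * v.re + b * v.im, b * v.re + d * v.im⟩ := by
  apply Complex.ext <;> simp [symmMap]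

/-- Derivative of the isothermal coordinate in terms of the slopes. -/
def isoForm (p q : ℝ) : ℂ →L[ℝ] ℂ :=
  symmMap (1 + (1 + p ^ 2) / areaDensity p q) (p * q / areaDensity p q)
    (1 + (1 + q ^ 2) / areaDensity p q)

lemma isoForm_eq (p q : ℝ) : isoForm p q = chartDerivInv (gaussMap p q) := by
  have hW := areaDensity_sq p q
  have h1 := areaDensity_pos p q
  ext v
  rw [chartDerivInv_apply, isoForm, symmMap_apply,
    show ‖gaussMap p q‖ ^ 4 = (‖gaussMap p q‖ ^ 2) ^ 2 by ring, normSq_gaussMap]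
  have : 2 / (1 - ((areaDensity p q - 1) / (areaDensity p q + 1)) ^ 2)
     = (areaDensity p q + 1) ^ 2 / (2 * areaDensity p q) := by
    have : (1 - ((areaDensity p q - 1) / (areaDensity p q + 1)) ^ 2)
      = 4 * areaDensity p q / (areaDensity p q + 1) ^ 2 := by field_simp; ring
    rw [this]; field_simp; ring
  rw [this]
  apply Complex.ext
  · rw [Complex.re_ofReal_mul]
    simp [gaussMap, pow_two]
    field_simp
    linear_combination (-v.re * (1 + areaDensity p q) ^ 2) * hW
  · rw [Complex.im_ofReal_mul]
    simp [gaussMap, pow_two]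
    field_simp
    linear_combination (-v.im * (1 + areaDensity p q) ^ 2) * hW


lemma HasFDerivAt.exists_div_real {a b : ℂ → ℝ} {a' b' : ℂ →L[ℝ] ℝ} {z : ℂ}
    (ha : HasFDerivAt a a' z) (hb : HasFDerivAt b b' z) (h0 : b z ≠ 0) :
    ∃ c' : ℂ →L[ℝ] ℝ, HasFDerivAt (fun z => a z / b z) c' z ∧
      ∀ v, c' v = (a' v * b z - a z * b' v) / b z ^ 2 := by
  refine ⟨_, ha.mul ((hasDerivAt_inv h0).comp_hasFDerivAt z hb), fun v => ?_⟩
  simp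
  field_simp
  ring

/-- The form `isoForm` is differentiable, and closed under the minimal surface equation. -/
lemma hasFDerivAt_isoForm {p q : ℂ → ℝ} {p' q' : ℂ →L[ℝ] ℝ} {z : ℂ}
    (hp : HasFDerivAt p p' z) (hq : HasFDerivAt q q' z) (hsymm : q' 1 = p' Complex.I)
    (hmse : (1 + q z ^ 2) * p' 1 - 2 * p z * q z * p' Complex.I
      + (1 + p z ^ 2) * q' Complex.I = 0) :
    ∃ ω' : ℂ →L[ℝ] ℂ →L[ℝ] ℂ, HasFDerivAt (fun z => isoForm (p z) (q z)) ω' z ∧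
      ∀ v w, ω' v w = ω' w v := by
  obtain ⟨W', hW', eW'⟩ := hasFDerivAt_areaDensity hp hq
  have hW := areaDensity_sq (p z) (q z)
  have h1 := areaDensity_pos (p z) (q z)
  have hpp : HasFDerivAt (fun z => 1 + p z ^ 2) ((2 * p z) • p') z := by
    refine HasFDerivAt.congr_fderiv ((hp.pow 2).const_add 1) ?_
    ext v; simp
  have hqq : HasFDerivAt (fun z => 1 + q z ^ 2) ((2 * q z) • q') z := by
    refine HasFDerivAt.congr_fderiv ((hq.pow 2).const_add 1) ?_
    ext v; simp
  have hpq : HasFDerivAt (fun z => p z * q z) (p z • q' + q z • p') z := hp.mul hq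
  obtain ⟨a', ha', ea'⟩ := hpp.exists_div_real hW' h1.ne'
  obtain ⟨b', hb', eb'⟩ := hpq.exists_div_real hW' h1.ne'
  obtain ⟨d', hd', ed'⟩ := hqq.exists_div_real hW' h1.ne'
  have hab : a' Complex.I = b' 1 := by
    rw [ea', eb', eW', eW']
    simp [hsymm]
    field_simp
    linear_combination (p z * p' Complex.I - p' 1 * q z) * hW - q z * hmse
  have hbd : b' Complex.I = d' 1 := by
    rw [eb', ed', eW', eW']
    simp [hsymm]
    field_simp
    linear_combination (p z * q' Complex.I - p' Complex.I * q z) * hW + p z * hmse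
  refine ⟨_, (((ha'.const_add 1).smul_const _).add (hb'.smul_const _)).add
    ((hd'.const_add 1).smul_const (Complex.I • Complex.ofRealCLM.comp Complex.imCLM)),
    fun v w => ?_⟩
  have key : ∀ (c' : ℂ →L[ℝ] ℝ) (v : ℂ), c' v = v.re * c' 1 + v.im * c' Complex.I := by
    intro c' v
    conv_lhs => rw [show v = v.re • (1 : ℂ) + v.im • Complex.I by
      apply Complex.ext <;> simp]
    rw [map_add, map_smul, map_smul, smul_eq_mul, smul_eq_mul]
  apply Complex.ext
  · simp
    rw [key a' v, key a' w, key b' v, key b' w, hab]; ring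
  · simp
    rw [key d' v, key d' w, key b' v, key b' w, hbd]; ring

/-- Under the minimal surface equation the Gauss map is holomorphic with respect to the
isothermal coordinate. -/
lemma hasFDerivAt_gaussMap {p q : ℂ → ℝ} {p' q' : ℂ →L[ℝ] ℝ} {z : ℂ}
    (hp : HasFDerivAt p p' z) (hq : HasFDerivAt q q' z) (hsymm : q' 1 = p' Complex.I)
    (hmse : (1 + q z ^ 2) * p' 1 - 2 * p z * q z * p' Complex.I
      + (1 + p z ^ 2) * q' Complex.I = 0) :
    ∃ (g' : ℂ →L[ℝ] ℂ) , HasFDerivAt (fun z => gaussMap (p z) (q z)) g' z ∧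
      g' 1 * isoForm (p z) (q z) Complex.I = g' Complex.I * isoForm (p z) (q z) 1 := by
  obtain ⟨W', hW', eW'⟩ := hasFDerivAt_areaDensity hp hq
  have hW := areaDensity_sq (p z) (q z)
  have h1 := areaDensity_pos (p z) (q z)
  have h2 : 1 + areaDensity (p z) (q z) ≠ 0 := by positivity
  obtain ⟨a', ha', ea'⟩ := hp.exists_div_real (hW'.const_add 1) h2
  obtain ⟨b', hb', eb'⟩ := hq.fun_neg.exists_div_real (hW'.const_add 1) h2
  have eg : ∀ v, (a'.smulRight (1 : ℂ) + b'.smulRight Complex.I) v = ⟨a' v, b' v⟩ := by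
    intro v; apply Complex.ext <;> simp
  refine ⟨a'.smulRight (1 : ℂ) + b'.smulRight Complex.I, ?_, ?_⟩
  · refine HasFDerivAt.congr_of_eventuallyEq ((ha'.smul_const 1).add (hb'.smul_const Complex.I))
      (.of_forall fun w => ?_)
    apply Complex.ext <;> simp [gaussMap, -Complex.ofReal_div, -Complex.ofReal_neg]
  · rw [isoForm, symmMap_apply, symmMap_apply, eg, eg, ea', eb', ea', eb', eW', eW']
    simp only [hsymm, neg_apply]
    generalize areaDensity (p z) (q z) = W at *
    apply Complex.ext
    · simp only [Complex.mul_re, Complex.I_re, Complex.I_im, Complex.one_re, Complex.one_im]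
      field_simp
      linear_combination (p z * q z * (p' 1 - q' Complex.I)
        + p' Complex.I * (q z ^ 2 - p z ^ 2)) * hW
    · simp only [Complex.mul_im, Complex.I_re, Complex.I_im, Complex.one_re, Complex.one_im]
      field_simp
      linear_combination (W + 1) ^ 2 * hmse + (p' 1 + q' Complex.I) * (W + 1) * hW

lemma apply_eq_re_im {F : Type*} [AddCommGroup F] [Module ℝ F] [TopologicalSpace F]
    (A : ℂ →L[ℝ] F) (v : ℂ) : A v = v.re • A 1 + v.im • A Complex.I := by
  conv_lhs => rw [show v = v.re • (1 : ℂ) + v.im • Complex.I by apply Complex.ext <;> simp]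
  rw [map_add, map_smul, map_smul]

lemma sq_add_sq_le_of_norm_le {A : ℂ →L[ℝ] ℝ} {L : ℝ} (hA : ‖A‖ ≤ L) :
    A 1 ^ 2 + A Complex.I ^ 2 ≤ L ^ 2 := by
  have h1 : A ⟨A 1, A Complex.I⟩ = A 1 ^ 2 + A Complex.I ^ 2 := by
    rw [apply_eq_re_im]; simp; ring
  have h2 := A.le_of_opNorm_le hA ⟨A 1, A Complex.I⟩
  have h3 : ‖(⟨A 1, A Complex.I⟩ : ℂ)‖ ^ 2 = A 1 ^ 2 + A Complex.I ^ 2 := by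
    rw [← Complex.normSq_eq_norm_sq, Complex.normSq_mk]; ring
  rw [h1, ← h3] at h2
  rw [Real.norm_of_nonneg (by positivity)] at h2
  rw [← h3]
  have h4 : 0 ≤ L := (norm_nonneg _).trans hA
  rcases (norm_nonneg (⟨A 1, A Complex.I⟩ : ℂ)).eq_or_lt with h | h
  · rw [← h]; simpa using sq_nonneg L
  · have : ‖(⟨A 1, A Complex.I⟩ : ℂ)‖ ≤ L := by nlinarith
    gcongr

lemma ContDiffAt.hasFDerivAt_fderiv_apply {f : ℂ → ℝ} {z : ℂ} (hf : ContDiffAt ℝ ∞ f z) (w : ℂ) :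
    HasFDerivAt (fun z => fderiv ℝ f z w)
      ((ContinuousLinearMap.apply ℝ ℝ w).comp (fderiv ℝ (fderiv ℝ f) z)) z := by
  have h : ContDiffAt ℝ 1 (fderiv ℝ f) z :=
    hf.fderiv_right (m := 1) (by norm_num; exact WithTop.coe_le_coe.2 le_top)
  exact (ContinuousLinearMap.apply ℝ ℝ w).hasFDerivAt.comp z
    (h.differentiableAt (by simp)).hasFDerivAt

lemma ContDiffAt.fderiv_fderiv_symm {f : ℂ → ℝ} {z : ℂ} (hf : ContDiffAt ℝ ∞ f z) (v w : ℂ) :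
    fderiv ℝ (fderiv ℝ f) z v w = fderiv ℝ (fderiv ℝ f) z w v :=
  hf.isSymmSndFDerivAt (by simp; exact WithTop.coe_le_coe.2 le_top) v w

lemma le_inner_isoForm (p q : ℝ) (v : ℂ) : ‖v‖ ^ 2 ≤ inner ℝ (isoForm p q v) v := by
  have h1 := areaDensity_pos p q
  rw [isoForm, symmMap_apply, Complex.inner, ← Complex.normSq_eq_norm_sq, Complex.normSq_apply]
  have : 0 ≤ (v.re ^ 2 + v.im ^ 2 + (p * v.re + q * v.im) ^ 2) / areaDensity p q := by positivity
  simp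
  field_simp at this ⊢
  nlinarith

/-- A map whose derivative dominates the identity is expanding. -/
lemma norm_sub_le_of_le_inner {T : ℂ → ℂ} {T' : ℂ → ℂ →L[ℝ] ℂ} {s : Set ℂ} (hs : Convex ℝ s)
    (hT : ∀ z ∈ s, HasFDerivAt T (T' z) z) (h : ∀ z ∈ s, ∀ v, ‖v‖ ^ 2 ≤ inner ℝ (T' z v) v)
    {a b : ℂ} (ha : a ∈ s) (hb : b ∈ s) : ‖a - b‖ ≤ ‖T a - T b‖ := by
  have hd : ∀ t ∈ Icc (0 : ℝ) 1, HasDerivAt (fun t : ℝ => inner ℝ (T (b + t • (a - b))) (a - b))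
      (inner ℝ (T' (b + t • (a - b)) (a - b)) (a - b)) t := by
    intro t ht
    have hm : b + t • (a - b) ∈ s := hs.add_smul_sub_mem hb ha ht
    have h1 : HasDerivAt (fun t : ℝ => b + t • (a - b)) (a - b) t := by
      simpa using ((hasDerivAt_id t).smul_const (a - b)).const_add b
    have h2 := (hT _ hm).comp_hasDerivAt t h1
    simpa using h2.inner ℝ (hasDerivAt_const t (a - b))
  obtain ⟨t, ht, he⟩ := exists_hasDerivAt_eq_slope _ _ (zero_lt_one (α := ℝ))
    (fun t ht => (hd t ht).continuousAt.continuousWithinAt)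
    (fun t ht => hd t (Ioo_subset_Icc_self ht))
  have h3 := h _ (hs.add_smul_sub_mem hb ha (Ioo_subset_Icc_self ht)) (a - b)
  rw [he] at h3
  simp only [one_smul, zero_smul, add_zero, sub_zero, div_one, add_sub_cancel,
    ← inner_sub_left] at h3
  have h4 := real_inner_le_norm (T a - T b) (a - b)
  rcases (norm_nonneg (a - b)).eq_or_lt with h0 | h0
  · rw [← h0]; positivity
  · nlinarith

/-- An expanding map with invertible derivative covers a ball of half the radius. -/
lemma exists_preimage_of_expanding {T : ℂ → ℂ} {T' : ℂ → ℂ ≃L[ℝ] ℂ} {c : ℂ} {ρ : ℝ}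
    (hT : ∀ z ∈ ball c ρ, HasFDerivAt T (T' z : ℂ →L[ℝ] ℂ) z)
    (hexp : ∀ a ∈ ball c ρ, ∀ b ∈ ball c ρ, ‖a - b‖ ≤ ‖T a - T b‖) (hc : T c = 0)
    {ζ : ℂ} (hζ : ζ ∈ ball (0 : ℂ) (ρ / 2)) : ∃ a ∈ ball c ρ, T a = ζ := by
  rw [mem_ball_zero_iff] at hζ
  obtain ⟨s, hs1, hs2⟩ := exists_between (show 2 * ‖ζ‖ < ρ by linarith)
  have hs0 : 0 < s := by linarith [norm_nonneg ζ]
  have hsub : closedBall c s ⊆ ball c ρ := closedBall_subset_ball hs2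
  have hcm : c ∈ closedBall c s := mem_closedBall_self hs0.le
  obtain ⟨a, ha, hmin⟩ := (isCompact_closedBall c s).exists_isMinOn ⟨c, hcm⟩
    (f := fun z => ‖T z - ζ‖ ^ 2)
    (fun z hz => (((hT z (hsub hz)).continuousAt.sub continuousAt_const).norm.pow
      2).continuousWithinAt)
  refine ⟨a, hsub ha, ?_⟩
  have h1 : ‖T a - ζ‖ ≤ ‖ζ‖ := by
    have := hmin hcm
    simp only [mem_ofPred_eq, hc, zero_sub, norm_neg] at this
    exact (pow_le_pow_iff_left₀ (norm_nonneg _) (norm_nonneg _) two_ne_zero).1 this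
  have h2 : ‖a - c‖ < s := by
    have h3 := hexp a (hsub ha) c (hsub hcm)
    rw [hc, sub_zero] at h3
    have h4 : ‖T a‖ ≤ ‖T a - ζ‖ + ‖ζ‖ := by simpa using norm_add_le (T a - ζ) ζ
    linarith
  have hloc : IsLocalMin (fun z => ‖T z - ζ‖ ^ 2) a := by
    refine hmin.isLocalMin (closedBall_mem_nhds_of_mem ?_)
    rwa [mem_ball, dist_eq_norm]
  have hd := hloc.hasFDerivAt_eq_zero ((hT a (hsub ha)).sub_const ζ).norm_sq
  have h5 := congrArg (fun A => A ((T' a).symm (T a - ζ))) hd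
  simp only [ContinuousLinearMap.comp_apply, smul_apply, innerSL_apply_apply,
    ContinuousLinearEquiv.coe_coe, ContinuousLinearEquiv.apply_symm_apply,
    zero_apply, smul_eq_zero] at h5
  have h6 := h5.resolve_left (by norm_num)
  exact sub_eq_zero.1 (inner_self_eq_zero.1 h6)

lemma reMul_comp_chartDeriv {g : ℂ} (hg : ‖g‖ < 1) :
    (reMul (2 * g / (1 - ‖g‖ ^ 2 : ℝ))).comp (chartDeriv g) = reMul g := by
  have h1 : (1 - ‖g‖ ^ 2 : ℝ) ≠ 0 :=
    (sub_pos.2 (pow_lt_one₀ (norm_nonneg _) hg (by norm_num))).ne'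
  ext v
  rw [ContinuousLinearMap.comp_apply, reMul_apply, reMul_apply, chartDeriv_apply,
    show 2 * g / ((1 - ‖g‖ ^ 2 : ℝ) : ℂ) * ((v - conj (g ^ 2 * v)) / 2) =
      g * (v - conj (g ^ 2 * v)) / ((1 - ‖g‖ ^ 2 : ℝ) : ℂ) by ring, Complex.div_ofReal_re,
    div_eq_iff h1, ← Complex.normSq_eq_norm_sq, Complex.normSq_apply]
  simp [pow_two]
  ring

/-- `ψ`, `γ` parametrize part of the graph of `f` by isothermal coordinates on a disc of radius
`s`, where `γ` is the Gauss map. -/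
structure IsothermalChart (f : ℂ → ℝ) (ψ γ : ℂ → ℂ) (s : ℝ) : Prop where
  holomorphic : DifferentiableOn ℂ γ (ball 0 s)
  norm_lt_one : ∀ ζ ∈ ball (0 : ℂ) s, ‖γ ζ‖ < 1
  hasFDerivAt : ∀ ζ ∈ ball (0 : ℂ) s, HasFDerivAt ψ (chartDeriv (γ ζ)) ζ
  height : ∀ ζ ∈ ball (0 : ℂ) s, HasFDerivAt (fun ζ => f (ψ ζ)) (reMul (γ ζ)) ζ

theorem exists_isothermalChart {f : ℂ → ℝ} {c : ℂ} {ρ L : ℝ} (hρ : 0 < ρ)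
    (h : ∀ z ∈ ball c ρ, SmoothMSEAt f z ∧ ‖fderiv ℝ f z‖ ≤ L) :
    ∃ ψ γ : ℂ → ℂ, IsothermalChart f ψ γ (ρ / 2) ∧ ψ 0 = c ∧
      MapsTo ψ (ball 0 (ρ / 2)) (ball c ρ) ∧
      (∀ ζ ∈ ball (0 : ℂ) (ρ / 2), ‖γ ζ‖ ≤ L / (1 + L)) ∧
      fderiv ℝ f c = reMul (2 * γ 0 / (1 - ‖γ 0‖ ^ 2 : ℝ)) := by
  have hcm : c ∈ ball c ρ := mem_ball_self hρ
  have hL : 0 ≤ L := (norm_nonneg _).trans (h c hcm).2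
  set p : ℂ → ℝ := fun z => fderiv ℝ f z 1 with hp
  set q : ℂ → ℝ := fun z => fderiv ℝ f z Complex.I with hq
  set g : ℂ → ℂ := fun z => gaussMap (p z) (q z) with hg
  have hpd := fun z hz => (h z hz).1.1.hasFDerivAt_fderiv_apply 1
  have hqd := fun z hz => (h z hz).1.1.hasFDerivAt_fderiv_apply Complex.I
  have hgle : ∀ z ∈ ball c ρ, ‖g z‖ ≤ L / (1 + L) := fun z hz =>
    norm_gaussMap_le (sq_add_sq_le_of_norm_le (h z hz).2) hL
  have hglt : ∀ z ∈ ball c ρ, ‖g z‖ < 1 := fun z hz =>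
    (hgle z hz).trans_lt (by rw [div_lt_one (by positivity)]; linarith)
  have hmse : ∀ z ∈ ball c ρ, (1 + q z ^ 2) * fderiv ℝ (fderiv ℝ f) z 1 1
      - 2 * p z * q z * fderiv ℝ (fderiv ℝ f) z Complex.I 1
      + (1 + p z ^ 2) * fderiv ℝ (fderiv ℝ f) z Complex.I Complex.I = 0 := by
    intro z hz
    have := (h z hz).1.2
    rwa [MSEAt, (h z hz).1.1.fderiv_fderiv_symm 1 Complex.I] at this
  have hform := fun z hz => hasFDerivAt_isoForm (hpd z hz) (hqd z hz)
    ((h z hz).1.1.fderiv_fderiv_symm 1 Complex.I) (hmse z hz)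
  have hgd := fun z hz => hasFDerivAt_gaussMap (hpd z hz) (hqd z hz)
    ((h z hz).1.1.fderiv_fderiv_symm 1 Complex.I) (hmse z hz)
  have hdiff : DifferentiableOn ℝ (fun z => isoForm (p z) (q z)) (ball c ρ) := fun z hz => by
    obtain ⟨A, hA, -⟩ := hform z hz
    exact hA.differentiableAt.differentiableWithinAt
  obtain ⟨T₀, hT₀⟩ := (convex_ball c ρ).exists_forall_hasFDerivAt_of_fderiv_symmetric isOpen_ball
    hdiff
    (fun z hz v w => by
      obtain ⟨A, hA, hs⟩ := hform z hz
      rw [hA.fderiv]; exact hs v w)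
  set T : ℂ → ℂ := fun z => T₀ z - T₀ c with hTdef
  have hT : ∀ z ∈ ball c ρ, HasFDerivAt T (isoForm (p z) (q z)) z := fun z hz =>
    (hT₀ z hz).sub_const _
  have hTc : T c = 0 := sub_self _
  have hexp : ∀ a ∈ ball c ρ, ∀ b ∈ ball c ρ, ‖a - b‖ ≤ ‖T a - T b‖ := fun a ha b hb =>
    norm_sub_le_of_le_inner (convex_ball c ρ) hT (fun z _ v => le_inner_isoForm _ _ v) ha hb
  have hg0 : ∀ z, ‖g z‖ < 1 := by
    intro z
    have h1 := areaDensity_pos (p z) (q z)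
    have := normSq_gaussMap (p z) (q z)
    have h2 : ‖g z‖ ^ 2 < 1 := by
      rw [hg, this, div_lt_one (by positivity)]; linarith
    exact (pow_lt_one_iff_of_nonneg (norm_nonneg _) two_ne_zero).1 h2
  have hsurj := fun ζ hζ => exists_preimage_of_expanding
    (T' := fun z => (chartEquiv (g z) (hg0 z)).symm)
    (fun z hz => by rw [chartEquiv_symm_coe, ← isoForm_eq]; exact hT z hz) hexp hTc (ζ := ζ) hζ
  choose! ψ hψm hψ using hsurj
  have hψL : ∀ a ∈ ball (0 : ℂ) (ρ / 2), ∀ b ∈ ball (0 : ℂ) (ρ / 2), ‖ψ a - ψ b‖ ≤ ‖a - b‖ := by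
    intro a ha b hb
    simpa [hψ a ha, hψ b hb] using hexp _ (hψm a ha) _ (hψm b hb)
  have hψd : ∀ ζ ∈ ball (0 : ℂ) (ρ / 2), HasFDerivAt ψ (chartDeriv (g (ψ ζ))) ζ := by
    intro ζ hζ
    have hn : ball (0 : ℂ) (ρ / 2) ∈ 𝓝 ζ := isOpen_ball.mem_nhds hζ
    have hcont : ContinuousAt ψ ζ := by
      rw [ContinuousAt, tendsto_iff_norm_sub_tendsto_zero]
      refine squeeze_zero' (.of_forall fun _ => norm_nonneg _)
        (g := fun a => ‖a - ζ‖) (by filter_upwards [hn] with a ha using hψL a ha ζ hζ) ?_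
      exact tendsto_iff_norm_sub_tendsto_zero.1 tendsto_id
    have := HasFDerivAt.of_local_left_inverse
      (f' := (chartEquiv (g (ψ ζ)) (hg0 _)).symm) hcont
      (by rw [chartEquiv_symm_coe, ← isoForm_eq]; exact hT _ (hψm ζ hζ))
      (by filter_upwards [hn] with a ha using hψ a ha)
    simpa using this
  have h0 : (0 : ℂ) ∈ ball (0 : ℂ) (ρ / 2) := mem_ball_self (by positivity)
  have hψ0 : ψ 0 = c := by
    have := hexp _ (hψm 0 h0) c hcm
    rw [hψ 0 h0, hTc, sub_zero, norm_zero] at this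
    exact sub_eq_zero.1 (norm_le_zero_iff.1 this)
  have hfd : ∀ z, fderiv ℝ f z = reMul (2 * g z / (1 - ‖g z‖ ^ 2 : ℝ)) := by
    intro z
    rw [hg, ← slopes_eq]
    ext v
    rw [apply_eq_re_im]
    simp [hp, hq]
    ring
  refine ⟨ψ, fun ζ => g (ψ ζ), ⟨?_, fun ζ hζ => hg0 _, hψd, ?_⟩, hψ0, hψm,
    fun ζ hζ => hgle _ (hψm ζ hζ), ?_⟩
  · intro ζ hζ
    obtain ⟨g', hg', he⟩ := hgd _ (hψm ζ hζ)
    have hcomp := hg'.comp ζ (hψd ζ hζ)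
    refine (differentiableAt_complex_iff_differentiableAt_real.2
      ⟨hcomp.differentiableAt, ?_⟩).differentiableWithinAt
    change fderiv ℝ ((fun z => gaussMap (fderiv ℝ f z 1) (fderiv ℝ f z Complex.I)) ∘ ψ) ζ Complex.I
      = Complex.I • fderiv ℝ ((fun z => gaussMap (fderiv ℝ f z 1) (fderiv ℝ f z Complex.I)) ∘ ψ) ζ 1
    rw [hcomp.fderiv]
    simp only [ContinuousLinearMap.comp_apply]
    have hinv : ∀ v, isoForm (p (ψ ζ)) (q (ψ ζ)) (chartDeriv (g (ψ ζ)) v) = v := by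
      intro v
      rw [isoForm_eq]
      exact (chartEquiv (g (ψ ζ)) (hg0 _)).symm_apply_apply v
    have hsw : ∀ v w, g' v * isoForm (p (ψ ζ)) (q (ψ ζ)) w =
        g' w * isoForm (p (ψ ζ)) (q (ψ ζ)) v := by
      intro v w
      rw [apply_eq_re_im g' v, apply_eq_re_im g' w, apply_eq_re_im (isoForm _ _) v,
        apply_eq_re_im (isoForm _ _) w]
      simp only [Complex.real_smul]
      linear_combination ((v.re : ℂ) * w.im - v.im * w.re) * he
    have := hsw (chartDeriv (g (ψ ζ)) 1) (chartDeriv (g (ψ ζ)) Complex.I)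
    rw [hinv, hinv, mul_one] at this
    rw [← this, smul_eq_mul, mul_comm]
  · intro ζ hζ
    have h1 := ((h _ (hψm ζ hζ)).1.1.differentiableAt (by simp)).hasFDerivAt.comp ζ (hψd ζ hζ)
    rw [hfd, reMul_comp_chartDeriv (hg0 _)] at h1
    exact h1
  · simp only [hψ0]; exact hfd c

/-- The derivative of `2γ / (1 - |γ|²)` in the direction `v`, when `γ' = κ`. -/
def slopeDeriv (g κ v : ℂ) : ℂ := 2 * (κ * v + g ^ 2 * conj (κ * v)) / ((1 - ‖g‖ ^ 2 : ℝ) : ℂ) ^ 2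

lemma mse_slopeDeriv {g κ : ℂ} (hg : ‖g‖ < 1) :
    (1 + (2 * g / (1 - ‖g‖ ^ 2 : ℝ)).im ^ 2) * (slopeDeriv g κ (chartDerivInv g 1)).re
      - 2 * (2 * g / (1 - ‖g‖ ^ 2 : ℝ)).re * (-(2 * g / (1 - ‖g‖ ^ 2 : ℝ)).im) *
        (-(slopeDeriv g κ (chartDerivInv g 1)).im)
      + (1 + (2 * g / (1 - ‖g‖ ^ 2 : ℝ)).re ^ 2) *
        (-(slopeDeriv g κ (chartDerivInv g Complex.I)).im) = 0 := by
  have h1 : (1 - ‖g‖ ^ 2 : ℝ) ≠ 0 :=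
    (sub_pos.2 (pow_lt_one₀ (norm_nonneg _) hg (by norm_num))).ne'
  have h4 : ‖g‖ ^ 2 = g.re ^ 2 + g.im ^ 2 := by
    rw [← Complex.normSq_eq_norm_sq, Complex.normSq_apply]; ring
  simp only [slopeDeriv, chartDerivInv_apply, ← Complex.ofReal_pow, Complex.div_ofReal_re,
    Complex.div_ofReal_im]
  generalize 2 / (1 - ‖g‖ ^ 4) = c at *
  generalize ‖g‖ ^ 2 = n at *
  obtain ⟨a, b⟩ := g
  obtain ⟨k, m⟩ := κ
  simp [pow_two] at h4 ⊢
  field_simp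
  subst h4
  ring

lemma hasFDerivAt_slope {γ : ℂ → ℂ} {κ z : ℂ} (h : HasDerivAt γ κ z) (hg : ‖γ z‖ < 1) :
    ∃ P' : ℂ →L[ℝ] ℂ, HasFDerivAt (fun ζ => 2 * γ ζ / (1 - ‖γ ζ‖ ^ 2 : ℝ)) P' z ∧
      ∀ v, P' v = slopeDeriv (γ z) κ v := by
  have hN : ∀ g : ℂ, ((1 - ‖g‖ ^ 2 : ℝ) : ℂ) = 1 - g * conj g := fun g => by
    rw [← Complex.normSq_eq_norm_sq, Complex.mul_conj]; push_cast; rfl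
  have h1 : (1 - γ z * conj (γ z)) ≠ 0 := by
    rw [← hN]
    exact Complex.ofReal_ne_zero.2
      (sub_pos.2 (pow_lt_one₀ (norm_nonneg _) hg (by norm_num))).ne'
  simp only [slopeDeriv, hN]
  have hγ : HasFDerivAt γ (ContinuousLinearMap.mul ℝ ℂ κ) z := by
    have := h.hasFDerivAt.restrictScalars ℝ
    refine this.congr_fderiv ?_
    ext v; simp [mul_comm]
  have hc : HasFDerivAt (fun ζ => conj (γ ζ)) _ z := (Complex.conjCLE.hasFDerivAt).comp z hγ
  have hd := ((hγ.mul hc).const_sub 1)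
  refine ⟨_, (hγ.const_mul 2).mul
    (((hasDerivAt_inv h1).hasFDerivAt.restrictScalars ℝ).comp z hd), fun v => ?_⟩
  simp
  field_simp
  ring

theorem IsothermalChart.smoothMSEAt {F : ℂ → ℝ} {ψ γ : ℂ → ℂ} {s : ℝ}
    (h : IsothermalChart F ψ γ s) (hs : 0 < s) :
    SmoothMSEAt F (ψ 0) ∧ fderiv ℝ F (ψ 0) = reMul (2 * γ 0 / (1 - ‖γ 0‖ ^ 2 : ℝ)) := by
  have h0 : (0 : ℂ) ∈ ball (0 : ℂ) s := mem_ball_self hs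
  have hn : ball (0 : ℂ) s ∈ 𝓝 (0 : ℂ) := isOpen_ball.mem_nhds h0
  have hγs : ContDiffOn ℝ ∞ γ (ball 0 s) :=
    (h.holomorphic.contDiffOn (n := ∞) isOpen_ball).restrict_scalars ℝ
  have hψs : ContDiffOn ℝ ∞ ψ (ball 0 s) := by
    rw [contDiffOn_infty_iff_fderiv_of_isOpen isOpen_ball]
    refine ⟨fun ζ hζ => (h.hasFDerivAt ζ hζ).differentiableAt.differentiableWithinAt, ?_⟩
    refine ContDiffOn.congr (f := fun ζ => chartDeriv (γ ζ)) ?_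
      (fun ζ hζ => (h.hasFDerivAt ζ hζ).fderiv)
    exact (contDiffOn_const (c := (1 / 2 : ℝ))).smul
      (contDiffOn_const.sub (contDiffOn_const.clm_comp
      ((ContinuousLinearMap.mul ℝ ℂ).contDiff.comp_contDiffOn (hγs.pow 2))))
  have hUs : ContDiffOn ℝ ∞ (fun ζ => F (ψ ζ)) (ball 0 s) := by
    rw [contDiffOn_infty_iff_fderiv_of_isOpen isOpen_ball]
    refine ⟨fun ζ hζ => (h.height ζ hζ).differentiableAt.differentiableWithinAt, ?_⟩
    refine ContDiffOn.congr (f := fun ζ => reMul (γ ζ)) ?_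
      (fun ζ hζ => (h.height ζ hζ).fderiv)
    exact contDiffOn_const.clm_comp
      ((ContinuousLinearMap.mul ℝ ℂ).contDiff.comp_contDiffOn hγs)
  have hψa : ContDiffAt ℝ ∞ ψ 0 := hψs.contDiffAt hn
  have hg : ‖γ 0‖ < 1 := h.norm_lt_one 0 h0
  have hψd : HasFDerivAt ψ (chartEquiv (γ 0) hg : ℂ →L[ℝ] ℂ) 0 := h.hasFDerivAt 0 h0
  have hTs := hψa.to_localInverse hψd (by simp)
  have hstrict := hψa.hasStrictFDerivAt' hψd (by simp)
  have hinv := hstrict.eventually_right_inverse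
  have hT0 : hψa.localInverse hψd (by simp) (ψ 0) = 0 := hstrict.localInverse_apply_image
  have hFs : ContDiffAt ℝ ∞ F (ψ 0) := by
    have h1 : ContDiffAt ℝ ∞ (fun ζ => F (ψ ζ)) (hψa.localInverse hψd (by simp) (ψ 0)) := by
      rw [hT0]; exact hUs.contDiffAt hn
    refine (h1.comp (ψ 0) hTs).congr_of_eventuallyEq ?_
    filter_upwards [hinv] with y hy
    exact (congrArg F hy).symm
  have hFd : ∀ᶠ ζ in 𝓝 (0 : ℂ), fderiv ℝ F (ψ ζ) =
      reMul (2 * γ ζ / (1 - ‖γ ζ‖ ^ 2 : ℝ)) := by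
    have h1 : ∀ᶠ y in 𝓝 (ψ 0), ContDiffAt ℝ 1 F y :=
      (hFs.of_le (WithTop.coe_le_coe.2 le_top)).eventually (by simp)
    filter_upwards [hψd.continuousAt.eventually h1, hn] with ζ hζ hm
    have h2 := ((hζ.differentiableAt (by simp)).hasFDerivAt.comp ζ (h.hasFDerivAt ζ hm)).unique
      (h.height ζ hm)
    rw [← reMul_comp_chartDeriv (h.norm_lt_one ζ hm)] at h2
    ext v
    have h3 := congrArg (fun A => A (chartDerivInv (γ ζ) v)) h2
    simp only [ContinuousLinearMap.comp_apply] at h3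
    have h4 : chartDeriv (γ ζ) (chartDerivInv (γ ζ) v) = v :=
      (chartEquiv (γ ζ) (h.norm_lt_one ζ hm)).apply_symm_apply v
    rwa [h4] at h3
  have hF0 := hFd.self_of_nhds
  refine ⟨⟨hFs, ?_⟩, hF0⟩
  obtain ⟨P', hP, hP'⟩ := hasFDerivAt_slope
    ((h.holomorphic.differentiableAt hn).hasDerivAt) hg
  have hsec : ∀ v w, fderiv ℝ (fderiv ℝ F) (ψ 0) v w =
      (slopeDeriv (γ 0) (deriv γ 0) (chartDerivInv (γ 0) v) * w).re := by
    intro v w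
    have h1 := (hFs.hasFDerivAt_fderiv_apply w).comp 0 hψd
    have h2 : HasFDerivAt (fun ζ => (2 * γ ζ / (1 - ‖γ ζ‖ ^ 2 : ℝ) * w).re) _ 0 :=
      Complex.reCLM.hasFDerivAt.comp 0 (hP.mul_const w)
    have h3 := (h2.congr_of_eventuallyEq (f₁ := (fun z => fderiv ℝ F z w) ∘ ψ)
      (by filter_upwards [hFd] with ζ hζ; simp [hζ])).unique h1
    have h4 := congrArg (fun A => A (chartDerivInv (γ 0) v)) h3
    have h5 : chartDeriv (γ 0) (chartDerivInv (γ 0) v) = v :=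
      (chartEquiv (γ 0) hg).apply_symm_apply v
    simp only [ContinuousLinearMap.comp_apply, chartEquiv_coe, h5] at h4
    rw [← hP']
    simpa [mul_comm] using h4.symm
  rw [MSEAt, hsec, hsec, hsec, hF0]
  have := mse_slopeDeriv (κ := deriv γ 0) hg
  simpa using this

/-- Near every point of `s`, the functions `f n` are eventually uniformly Lipschitz. -/
def EventuallyLocallyLipschitzOn {E F : Type*} [PseudoMetricSpace E] [PseudoMetricSpace F]
    (f : ℕ → E → F) (s : Set E) : Prop :=
  ∀ x ∈ s, ∃ δ > 0, ∃ K > 0, ∀ᶠ n in atTop, ∀ a ∈ ball x δ, ∀ b ∈ ball x δ,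
    dist (f n a) (f n b) ≤ K * dist a b

lemma EventuallyLocallyLipschitzOn.comp_strictMono {E F : Type*} [PseudoMetricSpace E]
    [PseudoMetricSpace F] {f : ℕ → E → F} {s : Set E} (h : EventuallyLocallyLipschitzOn f s)
    {φ : ℕ → ℕ} (hφ : StrictMono φ) : EventuallyLocallyLipschitzOn (fun n => f (φ n)) s := by
  intro x hx
  obtain ⟨δ, hδ, K, hK, hev⟩ := h x hx
  exact ⟨δ, hδ, K, hK, hφ.tendsto_atTop.eventually hev⟩

lemma EventuallyLocallyLipschitzOn.tendstoLocallyUniformlyOn {E F : Type*} [PseudoMetricSpace E]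
    [PseudoMetricSpace F] {f : ℕ → E → F} {g : E → F} {s : Set E}
    (h : EventuallyLocallyLipschitzOn f s)
    (hg : ∀ x ∈ s, Tendsto (fun n => f n x) atTop (𝓝 (g x))) :
    TendstoLocallyUniformlyOn f g atTop s := by
  rw [Metric.tendstoLocallyUniformlyOn_iff]
  intro ε hε x hx
  obtain ⟨δ, hδ, K, hK, hev⟩ := h x hx
  refine ⟨ball x (min δ (ε / (4 * K))) ∩ s,
    inter_mem (mem_nhdsWithin_of_mem_nhds (ball_mem_nhds _ (by positivity)))
      self_mem_nhdsWithin, ?_⟩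
  have hxδ : x ∈ ball x δ := mem_ball_self hδ
  have hlim : ∀ y ∈ ball x δ ∩ s, dist (g y) (g x) ≤ K * dist y x := fun y hy =>
    le_of_tendsto ((hg y hy.2).dist (hg x hx)) (by filter_upwards [hev] with n hn
                                                   exact hn y hy.1 x hxδ)
  filter_upwards [hev, Metric.tendsto_nhds.1 (hg x hx) (ε / 4) (by positivity)] with n hn hn2 y hy
  obtain ⟨hy1, hys⟩ := hy
  rw [mem_ball, lt_min_iff] at hy1
  have h1 := hlim y ⟨hy1.1, hys⟩
  have h2 := hn x hxδ y hy1.1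
  have h3 : K * dist y x < ε / 4 := by
    have := mul_lt_mul_of_pos_left hy1.2 hK
    rwa [show K * (ε / (4 * K)) = ε / 4 by field_simp] at this
  rw [dist_comm x y] at h2
  rw [dist_comm] at hn2
  have := dist_triangle4 (g y) (g x) (f n x) (f n y)
  linarith

/-- A version of the Arzelà–Ascoli theorem. -/
theorem EventuallyLocallyLipschitzOn.exists_subseq {E F : Type*} [PseudoMetricSpace E]
    [SecondCountableTopology E] [NormedAddCommGroup F] [ProperSpace F]
    {f : ℕ → E → F} {s : Set E} (h : EventuallyLocallyLipschitzOn f s)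
    (hb : ∀ x ∈ s, ∃ C, ∀ᶠ n in atTop, ‖f n x‖ ≤ C) :
    ∃ φ : ℕ → ℕ, StrictMono φ ∧ ∃ g : E → F,
      TendstoLocallyUniformlyOn (fun n => f (φ n)) g atTop s := by
  obtain ⟨D, hDc, hD⟩ := TopologicalSpace.exists_countable_dense s
  have : Countable D := hDc
  have hB : ∀ x : D, ∃ C, ∀ n, ‖f n x‖ ≤ C := by
    intro x
    obtain ⟨C, hC⟩ := hb x x.1.2
    obtain ⟨C', hC'⟩ := (isBoundedUnder_of_eventually_le hC).bddAbove_range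
    exact ⟨C', fun n => hC' ⟨n, rfl⟩⟩
  choose C hC using hB
  obtain ⟨G, -, φ, hφ, hG⟩ := (isCompact_univ_pi fun x : D => isCompact_closedBall (0 : F) (C x)
    ).tendsto_subseq (x := fun n (x : D) => f n x) (fun n x _ => by simpa using hC x n)
  rw [tendsto_pi_nhds] at hG
  have key : ∀ x ∈ s, ∃ y, Tendsto (fun n => f (φ n) x) atTop (𝓝 y) := by
    intro x hx
    refine cauchySeq_tendsto_of_complete (Metric.cauchySeq_iff'.2 fun ε hε => ?_)
    obtain ⟨δ, hδ, K, hK, hev⟩ := h.comp_strictMono hφ x hx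
    obtain ⟨d, hd, hdD⟩ := hD.exists_mem_open
      (isOpen_ball (x := (⟨x, hx⟩ : s)) (ε := min δ (ε / (4 * K))))
      ⟨_, mem_ball_self (by positivity)⟩
    rw [mem_ball, lt_min_iff, Subtype.dist_eq] at hdD
    have h3 : K * dist (d : E) x < ε / 4 := by
      have := mul_lt_mul_of_pos_left hdD.2 hK
      rwa [show K * (ε / (4 * K)) = ε / 4 by field_simp] at this
    obtain ⟨N₁, hN₁⟩ := eventually_atTop.1 hev
    obtain ⟨N₂, hN₂⟩ := Metric.cauchySeq_iff.1 (hG ⟨d, hd⟩).cauchySeq (ε / 4) (by positivity)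
    refine ⟨max N₁ N₂, fun n hn => ?_⟩
    have hxδ : x ∈ ball x δ := mem_ball_self hδ
    have h1 := hN₁ n (le_of_max_le_left hn) x hxδ d hdD.1
    have h2 := hN₁ (max N₁ N₂) (le_max_left _ _) d hdD.1 x hxδ
    have h4 : dist (f (φ n) d) (f (φ (max N₁ N₂)) d) < ε / 4 :=
      hN₂ n (le_of_max_le_right hn) _ (le_max_right _ _)
    rw [dist_comm x] at h1
    have := dist_triangle4 (f (φ n) x) (f (φ n) d) (f (φ (max N₁ N₂)) d) (f (φ (max N₁ N₂)) x)
    linarith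
  choose! g hg using key
  exact ⟨φ, hφ, g, (h.comp_strictMono hφ).tendstoLocallyUniformlyOn hg⟩

lemma norm_reMul_le (g : ℂ) : ‖reMul g‖ ≤ ‖g‖ :=
  ContinuousLinearMap.opNorm_le_bound _ (norm_nonneg _) fun v => by
    rw [reMul_apply, ← norm_mul]; exact Complex.abs_re_le_norm _

lemma norm_chartDeriv_le {g : ℂ} (hg : ‖g‖ < 1) : ‖chartDeriv g‖ ≤ 1 :=
  ContinuousLinearMap.opNorm_le_bound _ zero_le_one fun v => by
    rw [chartDeriv_apply, norm_div, Complex.norm_ofNat, one_mul, div_le_iff₀ two_pos]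
    refine (norm_sub_le _ _).trans ?_
    rw [Complex.norm_conj, norm_mul, norm_pow]
    have := pow_le_one₀ (n := 2) (norm_nonneg g) hg.le
    nlinarith [norm_nonneg v]

lemma norm_chartDeriv_sub_le {g k : ℂ} (hg : ‖g‖ < 1) (hk : ‖k‖ < 1) :
    ‖chartDeriv g - chartDeriv k‖ ≤ ‖g - k‖ :=
  ContinuousLinearMap.opNorm_le_bound _ (norm_nonneg _) fun v => by
    have h1 : (chartDeriv g - chartDeriv k) v = -conj ((g + k) * (g - k) * v) / 2 := by
      rw [sub_apply, chartDeriv_apply, chartDeriv_apply]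
      simp only [map_mul, map_add, map_sub, map_pow]
      ring
    rw [h1, norm_div, norm_neg, Complex.norm_conj, Complex.norm_ofNat, div_le_iff₀ two_pos,
      norm_mul, norm_mul]
    have := norm_add_le g k
    nlinarith [mul_nonneg (norm_nonneg (g - k)) (norm_nonneg v)]

lemma reMul_sub (g k : ℂ) : reMul g - reMul k = reMul (g - k) := by
  ext v; simp; ring

/-- Convergence of derivatives and of one value implies convergence of the functions. -/
lemma tendsto_of_hasFDerivAt_of_norm_sub_le {E : Type*} [NormedAddCommGroup E] [NormedSpace ℝ E]
    {G : ℕ → ℂ → E} {G₀ : ℂ → E} {A : ℕ → ℂ → ℂ →L[ℝ] E} {A₀ : ℂ → ℂ →L[ℝ] E}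
    {γ : ℕ → ℂ → ℂ} {γ₀ : ℂ → ℂ} {s : ℝ}
    (hG : ∀ n, ∀ ζ ∈ ball (0 : ℂ) s, HasFDerivAt (G n) (A n ζ) ζ)
    (hG₀ : ∀ ζ ∈ ball (0 : ℂ) s, HasFDerivAt G₀ (A₀ ζ) ζ)
    (hA : ∀ n, ∀ ζ ∈ ball (0 : ℂ) s, ‖A n ζ - A₀ ζ‖ ≤ ‖γ n ζ - γ₀ ζ‖)
    (hγ : TendstoLocallyUniformlyOn γ γ₀ atTop (ball 0 s))
    (h0 : Tendsto (fun n => G n 0) atTop (𝓝 (G₀ 0))) {ζ : ℂ} (hζ : ζ ∈ ball (0 : ℂ) s) :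
    Tendsto (fun n => G n ζ) atTop (𝓝 (G₀ ζ)) := by
  rw [mem_ball_zero_iff] at hζ
  have hsub : closedBall (0 : ℂ) ‖ζ‖ ⊆ ball 0 s := closedBall_subset_ball hζ
  have hu := (tendstoLocallyUniformlyOn_iff_forall_isCompact isOpen_ball).1 hγ _ hsub
    (isCompact_closedBall _ _)
  rw [Metric.tendstoUniformlyOn_iff] at hu
  rw [Metric.tendsto_nhds] at h0 ⊢
  intro ε hε
  filter_upwards [hu (ε / (2 * (‖ζ‖ + 1))) (by positivity), h0 (ε / 2) (by positivity)] with n h1 h2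
  have h3 := (convex_closedBall (0 : ℂ) ‖ζ‖).norm_image_sub_le_of_norm_hasFDerivWithin_le
    (f := fun ζ => G n ζ - G₀ ζ) (f' := fun ζ => A n ζ - A₀ ζ) (C := ε / (2 * (‖ζ‖ + 1)))
    (x := 0) (y := ζ)
    (fun z hz => ((hG n z (hsub hz)).sub (hG₀ z (hsub hz))).hasFDerivWithinAt)
    (fun z hz => (hA n z (hsub hz)).trans (by
      have := h1 z hz
      rw [dist_comm, dist_eq_norm] at this
      exact this.le)) (by simp) (by simp)
  rw [dist_eq_norm] at h2 ⊢
  have h4 : ε / (2 * (‖ζ‖ + 1)) * ‖ζ‖ ≤ ε / 2 := by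
    rw [div_mul_eq_mul_div, div_le_div_iff₀ (by positivity) two_pos]
    nlinarith
  have h5 := norm_add_le (G n ζ - G₀ ζ - (G n 0 - G₀ 0)) (G n 0 - G₀ 0)
  rw [sub_add_cancel] at h5
  rw [sub_zero] at h3
  linarith

lemma eventuallyLocallyLipschitzOn_of_bounded {γ : ℕ → ℂ → ℂ} {s m : ℝ}
    (hd : ∀ n, DifferentiableOn ℂ (γ n) (ball 0 s)) (hm : ∀ n, ∀ ζ ∈ ball (0 : ℂ) s, ‖γ n ζ‖ ≤ m) :
    EventuallyLocallyLipschitzOn γ (ball 0 s) := by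
  intro x hx
  obtain ⟨δ, hδ, hsub⟩ := Metric.isOpen_iff.1 isOpen_ball x hx
  have hm0 : 0 ≤ m := (norm_nonneg _).trans (hm 0 x hx)
  refine ⟨δ / 2, by positivity, (m + 1) / (δ / 2), by positivity, .of_forall fun n a ha b hb => ?_⟩
  have hy : ∀ y ∈ ball x (δ / 2), closedBall y (δ / 2) ⊆ ball 0 s := fun y hy =>
    (closedBall_subset_ball' (by rw [mem_ball] at hy; linarith)).trans hsub
  rw [dist_eq_norm, dist_eq_norm]
  refine (convex_ball x (δ / 2)).norm_image_sub_le_of_norm_deriv_le (𝕜 := ℂ) (fun y hy' => ?_)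
    (fun y hy' => ?_) hb ha
  · exact (hd n).differentiableAt
      (isOpen_ball.mem_nhds (hy y hy' (mem_closedBall_self (by positivity))))
  · refine Complex.norm_deriv_le_of_forall_mem_sphere_norm_le (by positivity)
      (DifferentiableOn.diffContOnCl ?_) fun z hz =>
        (hm n z (hy y hy' (sphere_subset_closedBall hz))).trans
        (by linarith)
    exact (hd n).mono (closure_ball_subset_closedBall.trans (hy y hy'))

lemma exists_chart_limit {γ : ℂ → ℂ} {s : ℝ} {c : ℂ} {a : ℝ}
    (hγ : DifferentiableOn ℂ γ (ball 0 s)) :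
    ∃ (ψ : ℂ → ℂ) (U : ℂ → ℝ), ψ 0 = c ∧ U 0 = a ∧
      (∀ ζ ∈ ball (0 : ℂ) s, HasFDerivAt ψ (chartDeriv (γ ζ)) ζ) ∧
      ∀ ζ ∈ ball (0 : ℂ) s, HasFDerivAt U (reMul (γ ζ)) ζ := by
  obtain ⟨H, hH⟩ := (hγ.pow 2).isExactOn_ball
  obtain ⟨Φ, hΦ⟩ := hγ.isExactOn_ball
  have hreal : ∀ {f : ℂ → ℂ} {k z : ℂ}, HasDerivAt f k z →
      HasFDerivAt f (ContinuousLinearMap.mul ℝ ℂ k) z := fun h => by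
    refine (h.hasFDerivAt.restrictScalars ℝ).congr_fderiv ?_
    ext v; simp [mul_comm]
  refine ⟨fun ζ => c + (1 / 2 : ℝ) • ((ζ - conj (H ζ)) - (0 - conj (H 0))),
    fun ζ => a + ((Φ ζ).re - (Φ 0).re), by simp, by simp, fun ζ hζ => ?_, fun ζ hζ => ?_⟩
  · exact (((((hasFDerivAt_id ζ).sub (Complex.conjCLE.hasFDerivAt.comp ζ (hreal (hH ζ hζ)))
      ).sub_const _).const_smul (1 / 2 : ℝ)).const_add c)
  · exact ((Complex.reCLM.hasFDerivAt.comp ζ (hreal (hΦ ζ hζ))).sub_const _).const_add a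

/-- A pointwise limit of minimal graphs with bounded slope is a minimal graph, and a subsequence
of the gradients converges. -/
lemma exists_subseq_smoothMSEAt {f : ℕ → ℂ → ℝ} {F : ℂ → ℝ} {c : ℂ} {ρ L : ℝ} (hρ : 0 < ρ)
    (h : ∀ n, ∀ z ∈ ball c ρ, SmoothMSEAt (f n) z ∧ ‖fderiv ℝ (f n) z‖ ≤ L)
    (hF : ∀ z ∈ ball c ρ, Tendsto (fun n => f n z) atTop (𝓝 (F z))) :
    SmoothMSEAt F c ∧ ∃ φ : ℕ → ℕ, StrictMono φ ∧
      Tendsto (fun n => fderiv ℝ (f (φ n)) c) atTop (𝓝 (fderiv ℝ F c)) := by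
  have hcm : c ∈ ball c ρ := mem_ball_self hρ
  have hL : 0 ≤ L := (norm_nonneg _).trans (h 0 c hcm).2
  have hm1 : L / (1 + L) < 1 := by rw [div_lt_one (by positivity)]; linarith
  choose ψ γ hch hψ0 hψm hγm hfd using fun n => exists_isothermalChart hρ (h n)
  obtain ⟨φ, hφ, γ₀, hγ₀⟩ := (eventuallyLocallyLipschitzOn_of_bounded
    (fun n => (hch n).holomorphic) hγm).exists_subseq
    (fun x hx => ⟨L / (1 + L), .of_forall fun n => hγm n x hx⟩)
  have hs : 0 < ρ / 2 := half_pos hρ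
  have h0 : (0 : ℂ) ∈ ball (0 : ℂ) (ρ / 2) := mem_ball_self hs
  have hγ₀d : DifferentiableOn ℂ γ₀ (ball 0 (ρ / 2)) :=
    hγ₀.differentiableOn (.of_forall fun n => (hch _).holomorphic) isOpen_ball
  have hγ₀1 : ∀ ζ ∈ ball (0 : ℂ) (ρ / 2), ‖γ₀ ζ‖ < 1 := fun ζ hζ =>
    (le_of_tendsto (hγ₀.tendsto_at hζ).norm (.of_forall fun n => hγm _ ζ hζ)).trans_lt hm1
  obtain ⟨ψ₀, U, hψ₀0, hU0, hψ₀, hU⟩ := exists_chart_limit (c := c) (a := F c) hγ₀d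
  have hψlim : ∀ ζ ∈ ball (0 : ℂ) (ρ / 2), Tendsto (fun n => ψ (φ n) ζ) atTop (𝓝 (ψ₀ ζ)) :=
    fun ζ hζ => tendsto_of_hasFDerivAt_of_norm_sub_le (fun n => (hch (φ n)).hasFDerivAt) hψ₀
      (fun n ξ hξ => norm_chartDeriv_sub_le ((hch _).norm_lt_one ξ hξ) (hγ₀1 ξ hξ)) hγ₀
      (by simp only [hψ0, hψ₀0]; exact tendsto_const_nhds) hζ
  have hUlim : ∀ ζ ∈ ball (0 : ℂ) (ρ / 2),
      Tendsto (fun n => f (φ n) (ψ (φ n) ζ)) atTop (𝓝 (U ζ)) :=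
    fun ζ hζ => tendsto_of_hasFDerivAt_of_norm_sub_le (fun n => (hch (φ n)).height) hU
      (fun n ξ hξ => by rw [reMul_sub]; exact norm_reMul_le _) hγ₀
      (by simp only [hψ0, hU0]; exact (hF c hcm).comp hφ.tendsto_atTop) hζ
  have hψ₀m : ∀ ζ ∈ ball (0 : ℂ) (ρ / 2), ψ₀ ζ ∈ ball c ρ := by
    intro ζ hζ
    have h1 := (convex_ball (0 : ℂ) (ρ / 2)).norm_image_sub_le_of_norm_hasFDerivWithin_le
      (fun z hz => (hψ₀ z hz).hasFDerivWithinAt)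
      (fun z hz => norm_chartDeriv_le (hγ₀1 z hz)) h0 hζ
    rw [hψ₀0, sub_zero] at h1
    rw [mem_ball_zero_iff] at hζ
    rw [mem_ball, dist_eq_norm]
    linarith
  have hFU : ∀ ζ ∈ ball (0 : ℂ) (ρ / 2), F (ψ₀ ζ) = U ζ := by
    intro ζ hζ
    refine tendsto_nhds_unique ((hF _ (hψ₀m ζ hζ)).comp hφ.tendsto_atTop) ?_
    have h1 : Tendsto (fun n => f (φ n) (ψ₀ ζ) - f (φ n) (ψ (φ n) ζ)) atTop (𝓝 0) := by
      refine squeeze_zero_norm (a := fun n => L * ‖ψ₀ ζ - ψ (φ n) ζ‖) (fun n => ?_) ?_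
      · exact (convex_ball c ρ).norm_image_sub_le_of_norm_hasFDerivWithin_le
          (fun z hz => ((h (φ n) z hz).1.1.differentiableAt
            (by simp)).hasFDerivAt.hasFDerivWithinAt)
          (fun z hz => (h (φ n) z hz).2) (hψm _ hζ) (hψ₀m ζ hζ)
      · simpa using ((tendsto_const_nhds (x := ψ₀ ζ)).sub (hψlim ζ hζ)).norm.const_mul L
    simpa [Function.comp_def] using h1.add (hUlim ζ hζ)
  have hchart : IsothermalChart F ψ₀ γ₀ (ρ / 2) := ⟨hγ₀d, hγ₀1, hψ₀, fun ζ hζ =>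
    (hU ζ hζ).congr_of_eventuallyEq (by
      filter_upwards [isOpen_ball.mem_nhds hζ] with ξ hξ using hFU ξ hξ)⟩
  obtain ⟨h1, h2⟩ := hchart.smoothMSEAt hs
  rw [hψ₀0] at h1 h2
  refine ⟨h1, φ, hφ, ?_⟩
  simp only [hfd, h2]
  have hne : ((1 - ‖γ₀ 0‖ ^ 2 : ℝ) : ℂ) ≠ 0 := Complex.ofReal_ne_zero.2
    (sub_pos.2 (pow_lt_one₀ (norm_nonneg _) (hγ₀1 0 h0) (by norm_num))).ne'
  have hγ0 := hγ₀.tendsto_at h0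
  have h3 : Tendsto (fun n => 2 * γ (φ n) 0 / ((1 - ‖γ (φ n) 0‖ ^ 2 : ℝ) : ℂ)) atTop
      (𝓝 (2 * γ₀ 0 / (1 - ‖γ₀ 0‖ ^ 2 : ℝ))) :=
    (hγ0.const_mul 2).div
      ((Complex.continuous_ofReal.tendsto _).comp ((hγ0.norm.pow 2).const_sub 1)) hne
  have h4 : Continuous reMul := by
    change Continuous fun g => Complex.reCLM.comp (ContinuousLinearMap.mul ℝ ℂ g)
    fun_prop
  exact (h4.tendsto _).comp h3

theorem smoothMSEAt_of_tendsto {f : ℕ → ℂ → ℝ} {F : ℂ → ℝ} {c : ℂ} {ρ L : ℝ} (hρ : 0 < ρ)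
    (h : ∀ᶠ n in atTop, ∀ z ∈ ball c ρ, SmoothMSEAt (f n) z ∧ ‖fderiv ℝ (f n) z‖ ≤ L)
    (hF : ∀ z ∈ ball c ρ, Tendsto (fun n => f n z) atTop (𝓝 (F z))) :
    SmoothMSEAt F c ∧ Tendsto (fun n => fderiv ℝ (f n) c) atTop (𝓝 (fderiv ℝ F c)) := by
  obtain ⟨N, hN⟩ := eventually_atTop.1 h
  refine ⟨(exists_subseq_smoothMSEAt hρ (f := fun n => f (n + N)) (fun n => hN _ (by omega))
    fun z hz => (tendsto_add_atTop_iff_nat N).2 (hF z hz)).1, ?_⟩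
  rw [← tendsto_add_atTop_iff_nat N]
  refine tendsto_of_subseq_tendsto fun ns hns => ?_
  obtain ⟨-, φ, -, h2⟩ := exists_subseq_smoothMSEAt hρ (f := fun n => f (ns n + N))
    (fun n => hN _ (by omega))
    fun z hz => ((tendsto_add_atTop_iff_nat N).2 (hF z hz)).comp hns
  exact ⟨φ, h2⟩

/-- Compactness of minimal graphs with bounded slope. -/
theorem exists_subseq_tendsto_minimal {f : ℕ → ℂ → ℝ} {Ω : Set ℂ} (hΩ : IsOpen Ω) {L : ℝ}
    (h : ∀ x ∈ Ω, ∃ δ > 0, ∀ᶠ n in atTop, ∀ z ∈ ball x δ,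
      SmoothMSEAt (f n) z ∧ ‖fderiv ℝ (f n) z‖ ≤ L)
    (hb : ∀ x ∈ Ω, ∃ C, ∀ᶠ n in atTop, ‖f n x‖ ≤ C) :
    ∃ φ : ℕ → ℕ, StrictMono φ ∧ ∃ g : ℂ → ℝ,
      TendstoLocallyUniformlyOn (fun n => f (φ n)) g atTop Ω ∧
      ∀ x ∈ Ω, SmoothMSEAt g x ∧ ‖fderiv ℝ g x‖ ≤ L ∧
        Tendsto (fun n => fderiv ℝ (f (φ n)) x) atTop (𝓝 (fderiv ℝ g x)) := by
  have hlip : EventuallyLocallyLipschitzOn f Ω := by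
    intro x hx
    obtain ⟨δ, hδ, hev⟩ := h x hx
    refine ⟨δ, hδ, |L| + 1, by positivity, ?_⟩
    filter_upwards [hev] with n hn a ha b hb
    rw [dist_eq_norm, dist_eq_norm]
    exact (convex_ball x δ).norm_image_sub_le_of_norm_hasFDerivWithin_le
      (fun z hz => ((hn z hz).1.1.differentiableAt (by simp)).hasFDerivAt.hasFDerivWithinAt)
      (fun z hz => (hn z hz).2.trans (by linarith [le_abs_self L])) hb ha
  obtain ⟨φ, hφ, g, hg⟩ := hlip.exists_subseq hb
  refine ⟨φ, hφ, g, hg, fun x hx => ?_⟩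
  obtain ⟨δ, hδ, hev⟩ := h x hx
  obtain ⟨δ', hδ', hsub⟩ := Metric.isOpen_iff.1 hΩ x hx
  have hev' := hφ.tendsto_atTop.eventually hev
  obtain ⟨h1, h2⟩ := smoothMSEAt_of_tendsto (f := fun n => f (φ n)) (F := g) (c := x)
    (lt_min hδ hδ')
    (hev'.mono fun n hn z hz => hn z (ball_subset_ball (min_le_left _ _) hz))
    (fun z hz => hg.tendsto_at (hsub (ball_subset_ball (min_le_right _ _) hz)))
  exact ⟨h1, le_of_tendsto h2.norm (hev'.mono fun n hn => (hn x (mem_ball_self hδ)).2), h2⟩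

/-- The graph of `f` translated vertically by `-b`, scaled by `1 / |a|` and rotated by `arg a`. -/
def rescale (f : ℂ → ℝ) (a : ℂ) (b : ℝ) (z : ℂ) : ℝ := ‖a‖⁻¹ * (f (a * z) - b)

lemma hasFDerivAt_rescale {f : ℂ → ℝ} {a z : ℂ} (b : ℝ) (hf : DifferentiableAt ℝ f (a * z)) :
    HasFDerivAt (rescale f a b)
      (‖a‖⁻¹ • (fderiv ℝ f (a * z)).comp (ContinuousLinearMap.mul ℝ ℂ a)) z :=
  ((hf.hasFDerivAt.comp z (ContinuousLinearMap.mul ℝ ℂ a).hasFDerivAt).sub_const b).const_mul ‖a‖⁻¹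

lemma fderiv_rescale_apply {f : ℂ → ℝ} {a z : ℂ} (b : ℝ) (hf : DifferentiableAt ℝ f (a * z))
    (w : ℂ) : fderiv ℝ (rescale f a b) z w = ‖a‖⁻¹ * fderiv ℝ f (a * z) (a * w) := by
  rw [(hasFDerivAt_rescale b hf).fderiv]; rfl

lemma norm_fderiv_rescale {f : ℂ → ℝ} {a z : ℂ} (b : ℝ) (ha : a ≠ 0)
    (hf : DifferentiableAt ℝ f (a * z)) :
    ‖fderiv ℝ (rescale f a b) z‖ = ‖fderiv ℝ f (a * z)‖ := by
  have ha' : 0 < ‖a‖ := norm_pos_iff.2 ha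
  refine le_antisymm (ContinuousLinearMap.opNorm_le_bound _ (norm_nonneg _) fun w => ?_)
    (ContinuousLinearMap.opNorm_le_bound _ (norm_nonneg _) fun w => ?_)
  · rw [fderiv_rescale_apply b hf, norm_mul, norm_inv, norm_norm, inv_mul_le_iff₀ ha']
    refine ((fderiv ℝ f (a * z)).le_opNorm _).trans (le_of_eq ?_)
    rw [norm_mul]; ring
  · have h1 : fderiv ℝ f (a * z) w = ‖a‖ * fderiv ℝ (rescale f a b) z (a⁻¹ * w) := by
      rw [fderiv_rescale_apply b hf, mul_inv_cancel_left₀ ha, mul_inv_cancel_left₀ ha'.ne']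
    rw [h1, norm_mul, norm_norm]
    have h2 := (fderiv ℝ (rescale f a b) z).le_opNorm (a⁻¹ * w)
    rw [norm_mul, norm_inv] at h2
    calc _ ≤ ‖a‖ * (‖fderiv ℝ (rescale f a b) z‖ * (‖a‖⁻¹ * ‖w‖)) := by gcongr
      _ = _ := by field_simp

lemma SmoothMSEAt.rescale {f : ℂ → ℝ} {a z : ℂ} (b : ℝ) (ha : a ≠ 0)
    (hf : SmoothMSEAt f (a * z)) : SmoothMSEAt (rescale f a b) z := by
  have ha' : 0 < ‖a‖ := norm_pos_iff.2 ha
  have hmul : ContDiff ℝ ∞ (fun z : ℂ => a * z) := contDiff_const.mul contDiff_id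
  refine ⟨contDiffAt_const.mul ((ContDiffAt.comp z (g := f) hf.1 hmul.contDiffAt).sub
    contDiffAt_const), ?_⟩
  have hd : ∀ᶠ y in 𝓝 (a * z), ContDiffAt ℝ 1 f y :=
    (hf.1.of_le (WithTop.coe_le_coe.2 le_top)).eventually (by simp)
  have hd' : ∀ᶠ y in 𝓝 z, DifferentiableAt ℝ f (a * y) :=
    (hmul.continuous.continuousAt.eventually hd).mono fun y hy => hy.differentiableAt (by simp)
  have hsm : ContDiffAt ℝ ∞ (_root_.rescale f a b) z :=
    contDiffAt_const.mul ((ContDiffAt.comp z (g := f) hf.1 hmul.contDiffAt).sub contDiffAt_const)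
  have h2 : ∀ v w, fderiv ℝ (fderiv ℝ (_root_.rescale f a b)) z v w =
      ‖a‖⁻¹ * fderiv ℝ (fderiv ℝ f) (a * z) (a * v) (a * w) := by
    intro v w
    have e1 := hsm.hasFDerivAt_fderiv_apply w
    have e2 := ((hf.1.hasFDerivAt_fderiv_apply (a * w)).comp z
      (ContinuousLinearMap.mul ℝ ℂ a).hasFDerivAt).const_mul ‖a‖⁻¹
    have e3 := (e2.congr_of_eventuallyEq (f₁ := fun y => fderiv ℝ (_root_.rescale f a b) y w)
      (by filter_upwards [hd'] with y hy using fderiv_rescale_apply b hy w)).unique e1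
    exact (congrArg (fun A => A v) e3).symm
  have hsymm := hf.1.fderiv_fderiv_symm
  have hm := hf.2
  rw [MSEAt] at hm ⊢
  rw [h2, h2, h2, fderiv_rescale_apply b hd'.self_of_nhds, fderiv_rescale_apply b hd'.self_of_nhds]
  set B := fderiv ℝ (fderiv ℝ f) (a * z) with hB
  set A := fderiv ℝ f (a * z) with hA
  have hBB : ∀ v w, B v w = v.re * w.re * B 1 1 + (v.re * w.im + v.im * w.re) * B 1 Complex.I +
      v.im * w.im * B Complex.I Complex.I := by
    intro v w
    rw [apply_eq_re_im B v, add_apply, smul_apply, smul_apply,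
      apply_eq_re_im (B 1) w, apply_eq_re_im (B Complex.I) w, hsymm Complex.I 1]
    simp only [smul_eq_mul]
    ring
  rw [hBB (a * 1) (a * 1), hBB (a * 1) (a * Complex.I), hBB (a * Complex.I) (a * Complex.I),
    apply_eq_re_im A (a * 1), apply_eq_re_im A (a * Complex.I)]
  have hn : ‖a‖⁻¹ ^ 2 * (a.re ^ 2 + a.im ^ 2) = 1 := by
    have : a.re ^ 2 + a.im ^ 2 = ‖a‖ ^ 2 := by
      rw [← Complex.normSq_eq_norm_sq, Complex.normSq_apply]; ring
    rw [this]; field_simp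
  simp
  generalize ‖a‖⁻¹ = k at *
  linear_combination (k * (a.re ^ 2 + a.im ^ 2)) * hm + k * (a.re ^ 2 + a.im ^ 2) * (
    A Complex.I ^ 2 * B 1 1 - 2 * A 1 * A Complex.I * B 1 Complex.I
      + A 1 ^ 2 * B Complex.I Complex.I) * hn

/-- The second order necessary condition at a local maximum. -/
lemma fderiv_fderiv_nonpos_of_isLocalMax {f : ℂ → ℝ} {z : ℂ} (hf : ContDiffAt ℝ ∞ f z)
    (hmax : IsLocalMax f z) (v : ℂ) : fderiv ℝ (fderiv ℝ f) z v v ≤ 0 := by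
  by_contra! hpos
  set g : ℝ → ℝ := fun t => f (z + t • v) with hg
  have hline : ∀ t : ℝ, HasDerivAt (fun t : ℝ => z + t • v) v t := fun t => by
    simpa using ((hasDerivAt_id t).smul_const v).const_add z
  have hz : z + (0 : ℝ) • v = z := by simp
  have hcont : Tendsto (fun t : ℝ => z + t • v) (𝓝 0) (𝓝 z) := by
    have := (hline 0).continuousAt.tendsto
    rwa [hz] at this
  have hd : ∀ᶠ t in 𝓝 (0 : ℝ), ContDiffAt ℝ 1 f (z + t • v) :=
    hcont.eventually ((hf.of_le (WithTop.coe_le_coe.2 le_top)).eventually (by simp))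
  have h1 : deriv g =ᶠ[𝓝 0] fun t => fderiv ℝ f (z + t • v) v := by
    filter_upwards [hd] with t ht
    exact ((ht.differentiableAt (by simp)).hasFDerivAt.comp_hasDerivAt t (hline t)).deriv
  have h2 : deriv (deriv g) 0 = fderiv ℝ (fderiv ℝ f) z v v := by
    rw [h1.deriv_eq]
    have h3 := hf.hasFDerivAt_fderiv_apply v
    rw [← hz] at h3
    have h4 := (h3.comp_hasDerivAt (0 : ℝ) (hline 0)).deriv
    rw [hz] at h4
    exact h4
  have hgmax : IsLocalMax g 0 := by
    filter_upwards [hcont.eventually hmax] with t ht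
    simpa [hg] using ht
  have hgc : ContinuousAt g 0 := by
    refine ContinuousAt.comp (g := f) ?_ (hline 0).continuousAt
    rw [hz]; exact hf.continuousAt
  have hgmin := isLocalMin_of_deriv_deriv_pos (h2 ▸ hpos) hgmax.deriv_eq_zero hgc
  have hconst : g =ᶠ[𝓝 0] fun _ => g 0 := by
    filter_upwards [hgmax, hgmin] with t h5 h6 using le_antisymm h5 h6
  have h7 : deriv (deriv g) 0 = 0 := by
    rw [hconst.deriv.deriv_eq]; simp
  linarith

lemma MSE_ellipticity {A₁ A₂ : ℂ →L[ℝ] ℝ} {B₁ B₂ : ℂ →L[ℝ] ℂ →L[ℝ] ℝ} {L S h κ : ℝ}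
    (hm₁ : (1 + A₁ Complex.I ^ 2) * B₁ 1 1 - 2 * A₁ 1 * A₁ Complex.I * B₁ 1 Complex.I
      + (1 + A₁ 1 ^ 2) * B₁ Complex.I Complex.I = 0)
    (hm₂ : (1 + A₂ Complex.I ^ 2) * B₂ 1 1 - 2 * A₂ 1 * A₂ Complex.I * B₂ 1 Complex.I
      + (1 + A₂ 1 ^ 2) * B₂ Complex.I Complex.I = 0)
    (hs₁ : B₁ Complex.I 1 = B₁ 1 Complex.I) (hs₂ : B₂ Complex.I 1 = B₂ 1 Complex.I)
    (hA₁ : ‖A₁‖ ≤ L) (hA₂ : ‖A₂‖ ≤ L) (hB₂ : ‖B₂‖ ≤ S) (hh : 0 < h)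
    (hp : A₁ 1 = A₂ 1 - h) (hq : A₁ Complex.I = A₂ Complex.I)
    (hE : ∀ v, B₁ v v - B₂ v v + κ * h * v.re ^ 2 ≤ 0) : κ ≤ 4 * L * S := by
  have e1 := hE 1
  have e2 := hE Complex.I
  have e3 := hE ⟨A₁ Complex.I, -A₁ 1⟩
  have hBB : ∀ B : ℂ →L[ℝ] ℂ →L[ℝ] ℝ, B Complex.I 1 = B 1 Complex.I → ∀ v,
      B v v = v.re ^ 2 * B 1 1 + 2 * v.re * v.im * B 1 Complex.I +
      v.im ^ 2 * B Complex.I Complex.I := by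
    intro B hs v
    rw [apply_eq_re_im B v, add_apply, smul_apply, smul_apply,
      apply_eq_re_im (B 1) v, apply_eq_re_im (B Complex.I) v, hs]
    simp only [smul_eq_mul]
    ring
  rw [hBB _ hs₁, hBB _ hs₂] at e3
  simp only [Complex.one_re, Complex.I_re] at e1 e2 e3
  have hL : 0 ≤ L := (norm_nonneg _).trans hA₁
  have hS : 0 ≤ S := (norm_nonneg B₂).trans hB₂
  have bd : ∀ {A : ℂ →L[ℝ] ℝ}, ‖A‖ ≤ L → ∀ {v : ℂ}, ‖v‖ = 1 → |A v| ≤ L := fun hA v hv => by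
    simpa [hv] using ContinuousLinearMap.le_of_opNorm_le _ hA v
  have bB : ∀ {v w : ℂ}, ‖v‖ = 1 → ‖w‖ = 1 → |B₂ v w| ≤ S := fun {v w} hv hw => by
    have := B₂.le_opNorm₂ v w
    rw [hv, hw, mul_one, mul_one] at this
    exact this.trans hB₂
  have b1 : |A₁ Complex.I * B₂ 1 Complex.I| ≤ L * S := by
    rw [abs_mul]
    exact mul_le_mul (bd hA₁ (by simp)) (bB (by simp) (by simp)) (abs_nonneg _) hL
  have b2 : |A₁ 1 * B₂ Complex.I Complex.I| ≤ L * S := by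
    rw [abs_mul]
    exact mul_le_mul (bd hA₁ (by simp)) (bB (by simp) (by simp)) (abs_nonneg _) hL
  have b3 : |A₂ 1 * B₂ Complex.I Complex.I| ≤ L * S := by
    rw [abs_mul]
    exact mul_le_mul (bd hA₂ (by simp)) (bB (by simp) (by simp)) (abs_nonneg _) hL
  rw [abs_le] at b1 b2 b3
  by_contra! hκ
  have hκ0 : 0 ≤ κ := le_trans (by positivity) hκ.le
  have key : κ * h * (1 + A₁ Complex.I ^ 2) ≤ h * (2 * (A₁ Complex.I * B₂ 1 Complex.I)
      - A₁ 1 * B₂ Complex.I Complex.I - A₂ 1 * B₂ Complex.I Complex.I) := by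
    rw [← hq] at hm₂
    have hp' : A₂ 1 = A₁ 1 + h := by linarith
    rw [hp'] at hm₂ ⊢
    nlinarith
  have k2 : κ * h ≤ κ * h * (1 + A₁ Complex.I ^ 2) :=
    le_mul_of_one_le_right (by positivity) (by nlinarith [sq_nonneg (A₁ Complex.I)])
  have k3 : h * κ ≤ h * (2 * (A₁ Complex.I * B₂ 1 Complex.I)
      - A₁ 1 * B₂ Complex.I Complex.I - A₂ 1 * B₂ Complex.I Complex.I) := by linarith
  have k4 := le_of_mul_le_mul_left k3 hh
  linarith

/-- The comparison principle for minimal graphs. -/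
theorem sub_le_of_minimal {u₁ u₂ : ℂ → ℝ} {K O : Set ℂ} {L M : ℝ} (hK : IsCompact K)
    (hO : IsOpen O) (hOK : O ⊆ K) (hc₁ : ContinuousOn u₁ K) (hc₂ : ContinuousOn u₂ K)
    (h₁ : ∀ z ∈ O, SmoothMSEAt u₁ z ∧ ‖fderiv ℝ u₁ z‖ ≤ L)
    (h₂ : ∀ z ∈ O, SmoothMSEAt u₂ z ∧ ‖fderiv ℝ u₂ z‖ ≤ L)
    (hb : ∀ z ∈ K \ O, u₁ z - u₂ z ≤ M) {z : ℂ} (hz : z ∈ K) : u₁ z - u₂ z ≤ M := by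
  by_contra! hlt
  set ε : ℝ := (u₁ z - u₂ z - M) / 2 with hε
  have hε0 : 0 < ε := by rw [hε]; linarith
  set K' : Set ℂ := K ∩ (fun z => u₁ z - u₂ z) ⁻¹' Ici (M + ε) with hK'
  have hK'c : IsCompact K' := hK.of_isClosed_subset
    ((hc₁.sub hc₂).preimage_isClosed_of_isClosed hK.isClosed isClosed_Ici) inter_subset_left
  have hK'O : K' ⊆ O := by
    intro y hy
    by_contra hn
    have h3 := hb y ⟨hy.1, hn⟩
    have h4 : M + ε ≤ u₁ y - u₂ y := hy.2
    linarith
  have hzK' : z ∈ K' := ⟨hz, by change M + ε ≤ u₁ z - u₂ z; rw [hε]; linarith⟩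
  have hL : 0 ≤ L := (norm_nonneg _).trans (h₁ z (hK'O hzK')).2
  obtain ⟨S, hS⟩ := hK'c.exists_bound_of_continuousOn (f := fderiv ℝ (fderiv ℝ u₂))
    (fun y hy => by
      have h3 : ContDiffAt ℝ 1 (fderiv ℝ u₂) y :=
        (h₂ y (hK'O hy)).1.1.fderiv_right (m := 1) (by norm_num; exact WithTop.coe_le_coe.2 le_top)
      have h4 : ContDiffAt ℝ 0 (fderiv ℝ (fderiv ℝ u₂)) y := h3.fderiv_right (m := 0) (by simp)
      exact h4.continuousAt.continuousWithinAt)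
  have hS0 : 0 ≤ S := (norm_nonneg _).trans (hS z hzK')
  obtain ⟨X, hX⟩ := hK.exists_bound_of_continuousOn (f := fun z : ℂ => z.re)
    Complex.continuous_re.continuousOn
  set κ : ℝ := 4 * L * S + 1 with hκ
  have hκ0 : 0 < κ := by positivity
  set δ : ℝ := ε / 2 * Real.exp (-(κ * X)) with hδ
  have hδ0 : 0 < δ := by positivity
  have hexp : ∀ y ∈ K, δ * Real.exp (κ * y.re) ≤ ε / 2 := by
    intro y hy
    rw [hδ, mul_assoc, ← Real.exp_add]
    have h3 : y.re ≤ X := (le_abs_self _).trans (hX y hy)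
    have h4 : -(κ * X) + κ * y.re ≤ 0 := by nlinarith
    have := Real.exp_le_one_iff.2 h4
    nlinarith
  set Φ : ℂ → ℝ := fun y => u₁ y - u₂ y + δ * Real.exp (κ * y.re) with hΦ
  have hec : ContDiff ℝ ∞ (fun y : ℂ => δ * Real.exp (κ * y.re)) :=
    contDiff_const.mul (Real.contDiff_exp.comp (contDiff_const.mul Complex.reCLM.contDiff))
  obtain ⟨x, hx, hmax⟩ := hK'c.exists_isMaxOn ⟨z, hzK'⟩ (f := Φ)
    (((hc₁.sub hc₂).mono inter_subset_left).add hec.continuous.continuousOn)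
  have hxO := hK'O hx
  have hOn : O ∈ 𝓝 x := hO.mem_nhds hxO
  have hwx : M + ε < u₁ x - u₂ x := by
    have h3 : Φ z ≤ Φ x := hmax hzK'
    simp only [hΦ] at h3
    have h4 := hexp x hx.1
    have h5 : 0 < δ * Real.exp (κ * z.re) := by positivity
    linarith
  have hwc : ContinuousAt (fun y => u₁ y - u₂ y) x :=
    (hc₁.sub hc₂).continuousAt (mem_of_superset hOn hOK)
  have hloc : IsLocalMax Φ x := by
    filter_upwards [hOn, hwc.eventually (lt_mem_nhds hwx)] with y hy1 hy2
    exact hmax ⟨hOK hy1, hy2.le⟩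
  obtain ⟨⟨s₁, m₁⟩, d₁⟩ := h₁ x hxO
  obtain ⟨⟨s₂, m₂⟩, d₂⟩ := h₂ x hxO
  have hΦs : ContDiffAt ℝ ∞ Φ x := (s₁.sub s₂).add hec.contDiffAt
  have hed : ∀ y : ℂ, HasFDerivAt (fun y : ℂ => Real.exp (κ * y.re))
      (Real.exp (κ * y.re) • κ • Complex.reCLM) y := fun y =>
    (Complex.reCLM.hasFDerivAt.const_mul κ).exp
  have hΦd : ∀ y ∈ O, ∀ v, fderiv ℝ Φ y v = fderiv ℝ u₁ y v - fderiv ℝ u₂ y v +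
      δ * (κ * v.re) * Real.exp (κ * y.re) := by
    intro y hy v
    have h3 := ((((h₁ y hy).1.1.differentiableAt (by simp)).hasFDerivAt.sub
      ((h₂ y hy).1.1.differentiableAt (by simp)).hasFDerivAt).add ((hed y).const_mul δ))
    have h4 := congrArg (fun A => A v) h3.fderiv
    refine h4.trans ?_
    simp
    ring
  have hΦ2 : ∀ v w, fderiv ℝ (fderiv ℝ Φ) x v w = fderiv ℝ (fderiv ℝ u₁) x v w
      - fderiv ℝ (fderiv ℝ u₂) x v w + δ * (κ * w.re) * (Real.exp (κ * x.re) * (κ * v.re)) := by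
    intro v w
    have h3 := ((s₁.hasFDerivAt_fderiv_apply w).sub (s₂.hasFDerivAt_fderiv_apply w)).add
      ((hed x).const_mul (δ * (κ * w.re)))
    have h4 := (h3.congr_of_eventuallyEq (f₁ := fun y => fderiv ℝ Φ y w)
      (by filter_upwards [hOn] with y hy using hΦd y hy w)).unique (hΦs.hasFDerivAt_fderiv_apply w)
    have h5 := congrArg (fun A => A v) h4
    refine h5.symm.trans ?_
    simp
  have hΦ0 := hloc.fderiv_eq_zero
  have hp := hΦd x hxO 1
  have hq := hΦd x hxO Complex.I
  rw [hΦ0] at hp hq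
  simp only [zero_apply, Complex.one_re, Complex.I_re, mul_one, mul_zero, zero_mul,
    add_zero] at hp hq
  have := MSE_ellipticity (κ := κ) (h := δ * κ * Real.exp (κ * x.re)) m₁ m₂
    (s₁.fderiv_fderiv_symm _ _) (s₂.fderiv_fderiv_symm _ _) d₁ d₂ (hS x hx) (by positivity)
    (by linarith) (by linarith) (fun v => by
      have h3 := fderiv_fderiv_nonpos_of_isLocalMax hΦs hloc v
      rw [hΦ2] at h3
      linarith)
  linarith

lemma abs_sub_le_of_norm_eq {u : ℂ → ℝ} {L : ℝ} {x y : ℂ} (hx : x ≠ 0) (hxy : ‖x‖ = ‖y‖)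
    (hu : ∀ z, ‖z‖ = ‖x‖ → DifferentiableAt ℝ u z ∧ ‖fderiv ℝ u z‖ ≤ L) :
    |u x - u y| ≤ Real.pi * L * ‖x‖ := by
  have hL : 0 ≤ L := (norm_nonneg _).trans (hu x rfl).2
  set c : ℝ → ℂ := fun t => x * Complex.exp (t * Complex.I) with hc
  have hcn : ∀ t, ‖c t‖ = ‖x‖ := fun t => by simp [hc, Complex.norm_exp_ofReal_mul_I]
  have hcd : ∀ t : ℝ, HasDerivAt c (x * (Complex.exp (t * Complex.I) * Complex.I)) t := by
    intro t
    have h1 : HasDerivAt (fun t : ℝ => (t : ℂ) * Complex.I) Complex.I t := by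
      simpa using (Complex.ofRealCLM.hasDerivAt (x := t)).mul_const Complex.I
    exact h1.cexp.const_mul x
  have h2 := (convex_univ (𝕜 := ℝ) (E := ℝ)).norm_image_sub_le_of_norm_hasDerivWithin_le
    (f := fun t => u (c t)) (C := L * ‖x‖) (x := (y / x).arg) (y := 0)
    (fun t _ => ((hu _ (hcn t)).1.hasFDerivAt.comp_hasDerivAt t (hcd t)).hasDerivWithinAt)
    (fun t _ => by
      refine ((fderiv ℝ u (c t)).le_opNorm _).trans ?_
      rw [norm_mul, norm_mul, Complex.norm_exp_ofReal_mul_I, Complex.norm_I, mul_one, mul_one]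
      exact mul_le_mul_of_nonneg_right (hu _ (hcn t)).2 (norm_nonneg _)) (mem_univ _) (mem_univ _)
  have h3 : c 0 = x := by simp [hc]
  have h4 : c (y / x).arg = y := by
    have := Complex.norm_mul_exp_arg_mul_I (y / x)
    rw [norm_div, hxy, div_self (by rw [← hxy]; exact norm_ne_zero_iff.2 hx), Complex.ofReal_one,
      one_mul] at this
    simp only [hc, this]
    field_simp
  rw [h3, h4, Real.norm_eq_abs, zero_sub, norm_neg, Real.norm_eq_abs] at h2
  refine h2.trans ?_
  have := mul_le_mul_of_nonneg_left (Complex.abs_arg_le_pi (y / x))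
    (by positivity : 0 ≤ L * ‖x‖)
  linarith

lemma abs_sub_le_radial_of_le {u : ℂ → ℝ} {L a b : ℝ} {e : ℂ} (he : ‖e‖ = 1) (ha : 0 < a)
    (hab : a ≤ b) (hc : ContinuousOn u {z | a ≤ ‖z‖ ∧ ‖z‖ ≤ b})
    (hu : ∀ z, a < ‖z‖ → ‖z‖ < b → DifferentiableAt ℝ u z ∧ ‖fderiv ℝ u z‖ ≤ L) :
    |u (b * e) - u (a * e)| ≤ L * (b - a) := by
  rcases hab.eq_or_lt with rfl | hab
  · simp
  have hn : ∀ t : ℝ, a ≤ t → ‖(t : ℂ) * e‖ = t := fun t ht => by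
    rw [norm_mul, he, mul_one, Complex.norm_real, Real.norm_of_nonneg (by linarith)]
  have hd : ∀ t : ℝ, HasDerivAt (fun t : ℝ => (t : ℂ) * e) e t := fun t => by
    simpa using (Complex.ofRealCLM.hasDerivAt (x := t)).mul_const e
  obtain ⟨t, ht, hs⟩ := exists_hasDerivAt_eq_slope (fun t : ℝ => u (t * e))
    (fun t => fderiv ℝ u (t * e) e) hab
    (hc.comp (fun t _ => (hd t).continuousAt.continuousWithinAt)
      (fun t ht => by
        change a ≤ ‖(t : ℂ) * e‖ ∧ ‖(t : ℂ) * e‖ ≤ b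
        rw [hn t ht.1]; exact ht))
    (fun t ht => ((hu _ (by rw [hn t ht.1.le]; exact ht.1)
      (by rw [hn t ht.1.le]; exact ht.2)).1.hasFDerivAt).comp_hasDerivAt t (hd t))
  have h1 := (fderiv ℝ u (t * e)).le_of_opNorm_le (hu _ (by rw [hn t ht.1.le]; exact ht.1)
      (by rw [hn t ht.1.le]; exact ht.2)).2 e
  rw [eq_div_iff (sub_pos.2 hab).ne'] at hs
  rw [← hs, abs_mul, abs_of_pos (sub_pos.2 hab)]
  rw [he, mul_one] at h1
  exact mul_le_mul_of_nonneg_right h1 (sub_pos.2 hab).le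

/-- Slope bounds on an annulus control the difference of values. -/
lemma abs_sub_le_of_annulus {u : ℂ → ℝ} {L s R : ℝ} (hs : 0 ≤ s)
    (hc : ContinuousOn u {z | s ≤ ‖z‖ ∧ ‖z‖ ≤ R})
    (hu : ∀ z, s < ‖z‖ → ‖z‖ < R → DifferentiableAt ℝ u z ∧ ‖fderiv ℝ u z‖ ≤ L)
    {x y : ℂ} (hx : s < ‖x‖) (hx' : ‖x‖ < R) (hy0 : y ≠ 0) (hy : s ≤ ‖y‖) (hy' : ‖y‖ ≤ R) :
    |u x - u y| ≤ Real.pi * L * ‖x‖ + L * |‖x‖ - ‖y‖| := by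
  have hx0 : 0 < ‖x‖ := hs.trans_lt hx
  have hyn : 0 < ‖y‖ := norm_pos_iff.2 hy0
  set e : ℂ := y / ‖y‖ with he
  have he1 : ‖e‖ = 1 := by rw [he, norm_div, Complex.norm_real, norm_norm, div_self hyn.ne']
  have hye : (‖y‖ : ℂ) * e = y := by
    rw [he, mul_div_cancel₀]; exact Complex.ofReal_ne_zero.2 hyn.ne'
  have hxe : ‖(‖x‖ : ℂ) * e‖ = ‖x‖ := by rw [norm_mul, he1, Complex.norm_real, norm_norm, mul_one]
  have h1 := abs_sub_le_of_norm_eq (u := u) (L := L) (norm_pos_iff.1 hx0) hxe.symm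
    (fun z hz => hu z (by rwa [hz]) (by rwa [hz]))
  have h2 : |u (‖x‖ * e) - u y| ≤ L * |‖x‖ - ‖y‖| := by
    rcases le_total ‖x‖ ‖y‖ with h | h
    · have := abs_sub_le_radial_of_le (u := u) (L := L) he1 hx0 h
        (hc.mono fun z hz => ⟨hx.le.trans hz.1, hz.2.trans hy'⟩)
        (fun z h1 h2 => hu z (hx.trans h1) (h2.trans_le hy'))
      rw [hye] at this
      rwa [abs_sub_comm, abs_sub_comm ‖x‖, abs_of_nonneg (sub_nonneg.2 h)]
    · have := abs_sub_le_radial_of_le (u := u) (L := L) he1 hyn h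
        (hc.mono fun z hz => ⟨hy.trans hz.1, hz.2.trans hx'.le⟩)
        (fun z h1 h2 => hu z (hy.trans_lt h1) (h2.trans hx'))
      rw [hye] at this
      rwa [abs_of_nonneg (sub_nonneg.2 h)]
  have := abs_sub_le (u x) (u (‖x‖ * e)) (u y)
  linarith

lemma abs_sub_le_of_exterior {u : ℂ → ℝ} {L s : ℝ} (hs : 0 ≤ s)
    (hu : ∀ z, s < ‖z‖ → DifferentiableAt ℝ u z ∧ ‖fderiv ℝ u z‖ ≤ L)
    {x y : ℂ} (hx : s < ‖x‖) (hy : s < ‖y‖) :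
    |u x - u y| ≤ Real.pi * L * ‖x‖ + L * |‖x‖ - ‖y‖| := by
  obtain ⟨t, ht1, ht2⟩ := exists_between (lt_min hx hy)
  rw [lt_min_iff] at ht2
  exact abs_sub_le_of_annulus (s := t) (R := ‖x‖ + ‖y‖) (hs.trans ht1.le)
    (fun z hz => (hu z (ht1.trans_le hz.1)).1.continuousAt.continuousWithinAt)
    (fun z hz _ => hu z (ht1.trans hz)) ht2.1 (by linarith) (norm_pos_iff.1 (hs.trans_lt hy))
    ht2.2.le (by linarith)

lemma isCompact_annulus (s R : ℝ) : IsCompact {z : ℂ | s ≤ ‖z‖ ∧ ‖z‖ ≤ R} := by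
  refine (isCompact_closedBall (0 : ℂ) R).of_isClosed_subset
    ((isClosed_le continuous_const continuous_norm).inter
      (isClosed_le continuous_norm continuous_const)) fun z hz => ?_
  simpa using hz.2

/-- A minimal graph over an annulus with zero outer boundary values is almost rotationally
symmetric. -/
lemma abs_rotation_sub_le {u : ℂ → ℝ} {L s R : ℝ} (hs : 0 < s)
    (hc : ContinuousOn u {z | s ≤ ‖z‖ ∧ ‖z‖ ≤ R})
    (hu : ∀ z, s < ‖z‖ → ‖z‖ < R → SmoothMSEAt u z ∧ ‖fderiv ℝ u z‖ ≤ L)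
    (hR : ∀ z, ‖z‖ = R → u z = 0) {a : ℂ} (ha : ‖a‖ = 1) {x : ℂ} (hx : s < ‖x‖) (hx' : ‖x‖ < R) :
    |u (a * x) - u x| ≤ Real.pi * L * s := by
  have hda : ∀ z, s < ‖z‖ → ‖z‖ < R → DifferentiableAt ℝ u z ∧ ‖fderiv ℝ u z‖ ≤ L :=
    fun z h1 h2 => ⟨(hu z h1 h2).1.1.differentiableAt (by simp), (hu z h1 h2).2⟩
  have ha0 : a ≠ 0 := norm_pos_iff.1 (by rw [ha]; exact one_pos)
  have han : ∀ z, ‖a * z‖ = ‖z‖ := fun z => by rw [norm_mul, ha, one_mul]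
  have hre : ∀ z, rescale u a 0 z = u (a * z) := fun z => by simp [rescale, ha]
  have key : ∀ t, s < t → t < ‖x‖ → |u (a * x) - u x| ≤ Real.pi * L * t := by
    intro t ht htx
    have hO : IsOpen {z : ℂ | t < ‖z‖ ∧ ‖z‖ < R} :=
      (isOpen_lt continuous_const continuous_norm).inter
        (isOpen_lt continuous_norm continuous_const)
    have hOK : {z : ℂ | t < ‖z‖ ∧ ‖z‖ < R} ⊆ {z | t ≤ ‖z‖ ∧ ‖z‖ ≤ R} :=
      fun z hz => ⟨hz.1.le, hz.2.le⟩
    have hc₂ : ContinuousOn u {z | t ≤ ‖z‖ ∧ ‖z‖ ≤ R} :=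
      hc.mono fun z hz => ⟨ht.le.trans hz.1, hz.2⟩
    have hc₁ : ContinuousOn (rescale u a 0) {z | t ≤ ‖z‖ ∧ ‖z‖ ≤ R} := by
      refine (hc₂.comp (f := fun z => a * z) (continuous_const.mul continuous_id).continuousOn
        (fun z hz => ?_)).congr fun z _ => hre z
      change t ≤ ‖a * z‖ ∧ ‖a * z‖ ≤ R
      rwa [han]
    have h₂ : ∀ z ∈ {z : ℂ | t < ‖z‖ ∧ ‖z‖ < R}, SmoothMSEAt u z ∧ ‖fderiv ℝ u z‖ ≤ L :=
      fun z hz => hu z (ht.trans hz.1) hz.2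
    have h₁ : ∀ z ∈ {z : ℂ | t < ‖z‖ ∧ ‖z‖ < R},
        SmoothMSEAt (rescale u a 0) z ∧ ‖fderiv ℝ (rescale u a 0) z‖ ≤ L := by
      intro z hz
      have := h₂ (a * z) (by change t < ‖a * z‖ ∧ ‖a * z‖ < R; rwa [han])
      refine ⟨this.1.rescale 0 ha0, ?_⟩
      rw [norm_fderiv_rescale 0 ha0 (this.1.1.differentiableAt (by simp))]
      exact this.2
    have hxm : x ∈ {z : ℂ | t ≤ ‖z‖ ∧ ‖z‖ ≤ R} := ⟨htx.le, hx'.le⟩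
    have hL : 0 ≤ L := (norm_nonneg _).trans (hu x hx hx').2
    have hbd : ∀ z ∈ {z : ℂ | t ≤ ‖z‖ ∧ ‖z‖ ≤ R} \ {z : ℂ | t < ‖z‖ ∧ ‖z‖ < R},
        |u (a * z) - u z| ≤ Real.pi * L * t := by
      intro z hz
      rcases hz.1.2.eq_or_lt with h | h
      · rw [hR z h, hR (a * z) (by rw [han, h]), sub_zero, abs_zero]
        have := Real.pi_pos
        have := hs.trans ht
        positivity
      · have hzt : ‖z‖ = t := by
          by_contra hne
          exact hz.2 ⟨lt_of_le_of_ne hz.1.1 (Ne.symm hne), h⟩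
        have h3 := abs_sub_le_of_norm_eq (u := u) (L := L) (x := a * z) (y := z)
          (norm_pos_iff.1 (by rw [han, hzt]; exact hs.trans ht)) (han z)
          (fun y hy => hda y (by rw [hy, han, hzt]; exact ht) (by rw [hy, han]; exact h))
        rwa [han, hzt] at h3
    have e1 := sub_le_of_minimal (isCompact_annulus t R) hO hOK hc₁ hc₂ h₁ h₂
      (fun z hz => by rw [hre]; exact (le_abs_self _).trans (hbd z hz)) hxm
    have e2 := sub_le_of_minimal (isCompact_annulus t R) hO hOK hc₂ hc₁ h₂ h₁
      (fun z hz => by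
        rw [hre]; exact (le_abs_self _).trans ((abs_sub_comm _ _).trans_le (hbd z hz))) hxm
    rw [hre] at e1 e2
    exact abs_le.2 ⟨by linarith, e1⟩
  have hlim : Tendsto (fun t => Real.pi * L * t) (𝓝[>] s) (𝓝 (Real.pi * L * s)) :=
    ((continuous_const.mul continuous_id).tendsto s).mono_left nhdsWithin_le_nhds
  refine ge_of_tendsto hlim ?_
  filter_upwards [Ioo_mem_nhdsGT hx] with t ht using key t ht.1 ht.2

/-- A rotationally symmetric minimal graph over the punctured plane with bounded slope is flat. -/
lemma fderiv_one_eq_zero_of_radial {w : ℂ → ℝ} {L : ℝ}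
    (hw : ∀ z, z ≠ 0 → SmoothMSEAt w z ∧ ‖fderiv ℝ w z‖ ≤ L)
    (hrad : ∀ a z, ‖a‖ = 1 → z ≠ 0 → w (a * z) = w z) : fderiv ℝ w 1 = 0 := by
  have h1 : ∀ z, z ≠ 0 → fderiv ℝ w z (Complex.I * z) = 0 := by
    intro z hz
    have hd : HasDerivAt (fun t : ℝ => Complex.exp (t * Complex.I) * z) (Complex.I * z) 0 := by
      have h1 : HasDerivAt (fun t : ℝ => (t : ℂ) * Complex.I) Complex.I 0 := by
        simpa using (Complex.ofRealCLM.hasDerivAt (x := 0)).mul_const Complex.I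
      simpa using h1.cexp.mul_const z
    have hwd : HasFDerivAt w (fderiv ℝ w z) (Complex.exp ((0 : ℝ) * Complex.I) * z) := by
      simpa using ((hw z hz).1.1.differentiableAt (by simp)).hasFDerivAt
    have h2 := hwd.comp_hasDerivAt 0 hd
    have h3 : w ∘ (fun t : ℝ => Complex.exp (t * Complex.I) * z) = fun _ => w z :=
      funext fun t => hrad _ z (Complex.norm_exp_ofReal_mul_I t) hz
    rw [h3] at h2
    exact h2.unique (hasDerivAt_const _ _)
  have hwy : ∀ t : ℝ, 0 < t → fderiv ℝ w t Complex.I = 0 := by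
    intro t ht
    have h2 := h1 t (Complex.ofReal_ne_zero.2 ht.ne')
    rw [show Complex.I * (t : ℂ) = t • Complex.I by rw [Complex.real_smul, mul_comm], map_smul,
      smul_eq_mul] at h2
    exact (mul_eq_zero.1 h2).resolve_left ht.ne'
  have hwyy : ∀ t : ℝ, 0 < t →
      t * fderiv ℝ (fderiv ℝ w) t Complex.I Complex.I = fderiv ℝ w t 1 := by
    intro t ht
    have ht0 : (t : ℂ) ≠ 0 := Complex.ofReal_ne_zero.2 ht.ne'
    have hs : ContDiffAt ℝ 1 (fderiv ℝ w) t :=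
      (hw t ht0).1.1.fderiv_right (m := 1) (by norm_num; exact WithTop.coe_le_coe.2 le_top)
    have h2 := (hs.differentiableAt (by simp)).hasFDerivAt.clm_apply
      (ContinuousLinearMap.mul ℝ ℂ Complex.I).hasFDerivAt
    have h3 : (fun z => fderiv ℝ w z (ContinuousLinearMap.mul ℝ ℂ Complex.I z)) =ᶠ[𝓝 (t : ℂ)]
        fun _ => 0 := by
      filter_upwards [isOpen_ne.mem_nhds ht0] with z hz using h1 z hz
    have h4 := congrArg (fun A => A Complex.I)
      ((h2.congr_of_eventuallyEq h3.symm).unique (hasFDerivAt_const (0 : ℝ) (t : ℂ)))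
    simp only [add_apply, ContinuousLinearMap.comp_apply, ContinuousLinearMap.flip_apply,
      ContinuousLinearMap.mul_apply', zero_apply, Complex.I_mul_I] at h4
    rw [show Complex.I * (t : ℂ) = t • Complex.I by rw [Complex.real_smul, mul_comm], map_smul,
      map_neg, smul_eq_mul] at h4
    linarith
  set p : ℝ → ℝ := fun t => fderiv ℝ w t 1 with hp
  have hpd : ∀ t : ℝ, 0 < t → HasDerivAt p (fderiv ℝ (fderiv ℝ w) t 1 1) t := by
    intro t ht
    have ht0 : (t : ℂ) ≠ 0 := Complex.ofReal_ne_zero.2 ht.ne'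
    exact ((hw t ht0).1.1.hasFDerivAt_fderiv_apply 1).comp_hasDerivAt t
      (Complex.ofRealCLM.hasDerivAt (x := t))
  have hode : ∀ t : ℝ, 0 < t →
      t * fderiv ℝ (fderiv ℝ w) t 1 1 = -((1 + p t ^ 2) * p t) := by
    intro t ht
    have ht0 : (t : ℂ) ≠ 0 := Complex.ofReal_ne_zero.2 ht.ne'
    have hm := (hw t ht0).1.2
    rw [MSEAt, hwy t ht] at hm
    have h2 := hwyy t ht
    simp only [hp]
    linear_combination t * hm - (1 + fderiv ℝ w t 1 ^ 2) * h2
  have hG : ∀ t : ℝ, 0 < t → HasDerivAt (fun t => (t * p t) ^ 2) (-(2 * t * p t ^ 4)) t := by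
    intro t ht
    refine (((hasDerivAt_id t).mul (hpd t ht)).pow 2).congr_deriv ?_
    have := hode t ht
    simp
    linear_combination 2 * t * p t * this
  have hanti : AntitoneOn (fun t => (t * p t) ^ 2) (Ioi 0) := by
    refine antitoneOn_of_deriv_nonpos (convex_Ioi 0)
      (fun t ht => (hG t ht).continuousAt.continuousWithinAt)
      (fun t ht => ?_) (fun t ht => ?_)
    · rw [interior_Ioi] at ht
      exact (hG t ht).differentiableAt.differentiableWithinAt
    · rw [interior_Ioi] at ht
      rw [(hG t ht).deriv]
      have : 0 < t := ht
      have : 0 ≤ 2 * t * p t ^ 4 := by positivity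
      linarith
  have hle : ∀ t : ℝ, t ∈ Ioo (0 : ℝ) 1 → (1 * p 1) ^ 2 ≤ t ^ 2 * L ^ 2 := by
    intro t ht
    refine (hanti (mem_Ioi.2 ht.1) (mem_Ioi.2 one_pos) ht.2.le).trans ?_
    have ht0 : (t : ℂ) ≠ 0 := Complex.ofReal_ne_zero.2 ht.1.ne'
    have h2 := sq_add_sq_le_of_norm_le (hw t ht0).2
    change (t * fderiv ℝ w t 1) ^ 2 ≤ _
    rw [mul_pow]
    nlinarith [sq_nonneg (fderiv ℝ w t Complex.I), sq_nonneg t]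
  have hlim : Tendsto (fun t : ℝ => t ^ 2 * L ^ 2) (𝓝[>] 0) (𝓝 (0 ^ 2 * L ^ 2)) :=
    (((continuous_id.pow 2).mul continuous_const).tendsto 0).mono_left nhdsWithin_le_nhds
  have h2 : (1 * p 1) ^ 2 ≤ 0 ^ 2 * L ^ 2 := by
    refine ge_of_tendsto hlim ?_
    filter_upwards [Ioo_mem_nhdsGT one_pos] with t ht using hle t ht
  have hp1 : p 1 = 0 := by nlinarith
  have hp2 := hwy 1 one_pos
  simp only [hp, Complex.ofReal_one] at hp1 hp2
  ext v
  rw [apply_eq_re_im, hp1, hp2]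
  simp

lemma norm_fderiv_lt_of_exterior {u : ℂ → ℝ} {L s C : ℝ} (hs : 0 ≤ s)
    (hu : ∀ z, s < ‖z‖ → SmoothMSEAt u z ∧ ‖fderiv ℝ u z‖ ≤ L)
    (hrot : ∀ a z, ‖a‖ = 1 → s < ‖z‖ → |u (a * z) - u z| ≤ C) {δ : ℝ} (hδ : 0 < δ) :
    ∃ R₀ : ℝ, ∀ z, R₀ ≤ ‖z‖ → ‖fderiv ℝ u z‖ < δ := by
  by_contra! hcon
  choose q hq hqδ using fun n : ℕ => hcon (n + s + 1)
  have hqs : ∀ n, s < ‖q n‖ := fun n => by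
    have := hq n
    have := n.cast_nonneg (α := ℝ)
    linarith
  have hqpos : ∀ n, 0 < ‖q n‖ := fun n => hs.trans_lt (hqs n)
  have hq0 : ∀ n, q n ≠ 0 := fun n => norm_pos_iff.1 (hqpos n)
  have hqtop : Tendsto (fun n => ‖q n‖) atTop atTop :=
    tendsto_atTop_mono (fun n => by have := hq n; linarith) tendsto_natCast_atTop_atTop
  have hd : ∀ z, s < ‖z‖ → DifferentiableAt ℝ u z ∧ ‖fderiv ℝ u z‖ ≤ L :=
    fun z hz => ⟨(hu z hz).1.1.differentiableAt (by simp), (hu z hz).2⟩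
  have hev : ∀ c > 0, ∀ᶠ n in atTop, s < ‖q n‖ * c := fun c hc =>
    (hqtop.atTop_mul_const hc).eventually_gt_atTop s
  obtain ⟨φ, hφ, w, hw, hw'⟩ := exists_subseq_tendsto_minimal
    (f := fun n => rescale u (q n) (u (q n))) (Ω := {0}ᶜ) (L := L) isOpen_compl_singleton
    (fun x hx => by
      have hx0 : 0 < ‖x‖ := norm_pos_iff.2 hx
      refine ⟨‖x‖ / 2, half_pos hx0, ?_⟩
      filter_upwards [hev (‖x‖ / 2) (half_pos hx0)] with n hn z hz
      have hz' : ‖x‖ / 2 < ‖z‖ := by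
        have h1 := norm_sub_norm_le x z
        have h2 : ‖x - z‖ < ‖x‖ / 2 := by rwa [← dist_eq_norm, dist_comm]
        linarith
      have hqz : s < ‖q n * z‖ := by
        rw [norm_mul]; exact hn.trans (mul_lt_mul_of_pos_left hz' (hqpos n))
      exact ⟨(hu _ hqz).1.rescale _ (hq0 n),
        (norm_fderiv_rescale _ (hq0 n) (hd _ hqz).1).trans_le (hd _ hqz).2⟩)
    (fun x hx => by
      have hx0 : 0 < ‖x‖ := norm_pos_iff.2 hx
      refine ⟨Real.pi * L * ‖x‖ + L * |‖x‖ - 1|, ?_⟩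
      filter_upwards [hev ‖x‖ hx0] with n hn
      have h1 := abs_sub_le_of_exterior hs hd (x := q n * x) (y := q n)
        (by rwa [norm_mul]) (hqs n)
      rw [rescale, norm_mul, norm_inv, norm_norm, Real.norm_eq_abs, inv_mul_le_iff₀ (hqpos n)]
      refine h1.trans (le_of_eq ?_)
      have : ‖q n * x‖ - ‖q n‖ = ‖q n‖ * (‖x‖ - 1) := by rw [norm_mul]; ring
      rw [this, abs_mul, abs_norm, norm_mul]
      ring)
  have hrad : ∀ a z, ‖a‖ = 1 → z ≠ 0 → w (a * z) = w z := by
    intro a z ha hz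
    have haz : a * z ≠ 0 := mul_ne_zero (norm_pos_iff.1 (by simp [ha])) hz
    have h1 := ((hw.tendsto_at haz).sub (hw.tendsto_at (show z ∈ {0}ᶜ from hz))).abs
    have h2 : Tendsto (fun n => ‖q (φ n)‖⁻¹ * C) atTop (𝓝 0) := by
      simpa using (hqtop.comp hφ.tendsto_atTop).inv_tendsto_atTop.mul_const C
    have h3 := le_of_tendsto_of_tendsto h1 h2 (by
      filter_upwards [hφ.tendsto_atTop.eventually (hev ‖z‖ (norm_pos_iff.2 hz))] with n hn
      have h4 := hrot a (q (φ n) * z) ha (by rwa [norm_mul])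
      have h5 : rescale u (q (φ n)) (u (q (φ n))) (a * z) - rescale u (q (φ n)) (u (q (φ n))) z
          = ‖q (φ n)‖⁻¹ * (u (a * (q (φ n) * z)) - u (q (φ n) * z)) := by
        rw [rescale, rescale, mul_left_comm]; ring
      rw [h5, abs_mul, abs_inv, abs_norm]
      gcongr)
    exact sub_eq_zero.1 (abs_nonpos_iff.1 h3)
  have h0 := fderiv_one_eq_zero_of_radial (fun z hz => ⟨(hw' z hz).1, (hw' z hz).2.1⟩) hrad
  have h1 := (hw' 1 (one_ne_zero)).2.2.norm
  have h2 := ge_of_tendsto' h1 (b := δ) fun n => by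
    rw [norm_fderiv_rescale _ (hq0 _) (by rw [mul_one]; exact (hd _ (hqs _)).1), mul_one]
    exact hqδ _
  rw [h0, norm_zero] at h2
  linarith

lemma exists_subseq_rescaled_annuli {R L : ℝ} (hR : 0 < R) (hL : 0 ≤ L) {r : ℕ → ℝ}
    (hrpos : ∀ i, 0 < r i) {u : ℕ → ℂ → ℝ}
    (hcont : ∀ i, ContinuousOn (u i) {z | r i ≤ ‖z‖ ∧ ‖z‖ ≤ R})
    (hsol : ∀ i z, r i < ‖z‖ → ‖z‖ < R → SmoothMSEAt (u i) z ∧ ‖fderiv ℝ (u i) z‖ ≤ L)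
    (hbdry : ∀ i z, ‖z‖ = R → u i z = 0) {l : ℕ → ℝ} (hl : Tendsto l atTop atTop) {r' : ℝ}
    (hr' : Tendsto (fun i => l i * r i) atTop (𝓝 r')) {v : ℕ → ℝ} {c : ℝ}
    (hv : ∀ i, ∃ p, r i ≤ ‖p‖ ∧ ‖p‖ ≤ R ∧ ‖p‖ ≤ c * r i ∧ |u i p - v i| ≤ c * r i) :
    ∃ φ : ℕ → ℕ, StrictMono φ ∧ ∃ u' : ℂ → ℝ, (∀ z, r' < ‖z‖ → SmoothMSEAt u' z) ∧
      TendstoLocallyUniformlyOn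
        (fun n z => l (φ n) * (u (φ n) ((l (φ n) : ℂ)⁻¹ * z) - v (φ n))) u' atTop {z | r' < ‖z‖} ∧
      ∀ δ > 0, ∃ R₀ : ℝ, ∀ z, R₀ ≤ ‖z‖ → ‖fderiv ℝ u' z‖ < δ := by
  have hlpos : ∀ᶠ n in atTop, 0 < l n := hl.eventually_gt_atTop 0
  have hr'0 : 0 ≤ r' := ge_of_tendsto hr' (by
    filter_upwards [hlpos] with n hn using (mul_pos hn (hrpos n)).le)
  have hlR : ∀ b, ∀ᶠ n in atTop, b < l n * R := fun b =>
    (hl.atTop_mul_const hR).eventually_gt_atTop b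
  have hlr : ∀ b, r' < b → ∀ᶠ n in atTop, l n * r n < b := fun b hb => hr'.eventually_lt_const hb
  have hd : ∀ i z, r i < ‖z‖ → ‖z‖ < R → DifferentiableAt ℝ (u i) z ∧ ‖fderiv ℝ (u i) z‖ ≤ L :=
    fun i z h1 h2 => ⟨(hsol i z h1 h2).1.1.differentiableAt (by simp), (hsol i z h1 h2).2⟩
  have hnorm : ∀ n, 0 < l n → ∀ z : ℂ, ‖((l n : ℂ))⁻¹ * z‖ = (l n)⁻¹ * ‖z‖ := fun n hn z => by
    rw [norm_mul, norm_inv, Complex.norm_real, Real.norm_of_nonneg hn.le]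
  have hmem : ∀ n, 0 < l n → ∀ z : ℂ, l n * r n < ‖z‖ → ‖z‖ < l n * R →
      r n < ‖((l n : ℂ))⁻¹ * z‖ ∧ ‖((l n : ℂ))⁻¹ * z‖ < R := fun n hn z h1 h2 => by
    rw [hnorm n hn, lt_inv_mul_iff₀ hn, inv_mul_lt_iff₀ hn]; exact ⟨h1, h2⟩
  set f : ℕ → ℂ → ℝ := fun n z => l n * (u n ((l n : ℂ)⁻¹ * z) - v n) with hf
  have hfr : ∀ n, 0 < l n → f n = rescale (u n) ((l n : ℂ)⁻¹) (v n) := fun n hn => by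
    funext z
    rw [hf, rescale, norm_inv, Complex.norm_real, Real.norm_of_nonneg hn.le, inv_inv]
  have hΩ : IsOpen {z : ℂ | r' < ‖z‖} := isOpen_lt continuous_const continuous_norm
  obtain ⟨φ, hφ, w, hw, hw'⟩ := exists_subseq_tendsto_minimal (f := f) hΩ (L := L)
    (fun x hx => by
      have hx0 : r' < ‖x‖ := hx
      refine ⟨(‖x‖ - r') / 2, by linarith, ?_⟩
      filter_upwards [hlpos, hlR (‖x‖ + (‖x‖ - r') / 2), hlr ((r' + ‖x‖) / 2) (by linarith)]
        with n hn h1 h2 z hz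
      have h3 : ‖x - z‖ < (‖x‖ - r') / 2 := by rwa [← dist_eq_norm, dist_comm]
      have h4 := norm_sub_norm_le x z
      have h5 := norm_sub_norm_le z x
      rw [norm_sub_rev] at h5
      have hm := hmem n hn z (by linarith) (by linarith)
      have hne : ((l n : ℂ))⁻¹ ≠ 0 := inv_ne_zero (Complex.ofReal_ne_zero.2 hn.ne')
      rw [hfr n hn]
      exact ⟨(hsol n _ hm.1 hm.2).1.rescale _ hne,
        (norm_fderiv_rescale _ hne (hd n _ hm.1 hm.2).1).trans_le (hd n _ hm.1 hm.2).2⟩)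
    (fun x hx => by
      have hx0 : r' < ‖x‖ := hx
      refine ⟨(Real.pi * L * ‖x‖ + L * (‖x‖ + |c| * (r' + 1))) + |c| * (r' + 1), ?_⟩
      filter_upwards [hlpos, hlR ‖x‖, hlr ‖x‖ hx0, hlr (r' + 1) (by linarith)]
        with n hn h1 h2 h3
      have hm := hmem n hn x h2 h1
      obtain ⟨p, hp, hpR, hpc, hpv⟩ := hv n
      have h4 := abs_sub_le_of_annulus (hrpos n).le (hcont n) (hd n) hm.1 hm.2
        (norm_pos_iff.1 ((hrpos n).trans_le hp)) hp hpR
      have h5 : l n * (c * r n) ≤ |c| * (r' + 1) := by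
        calc l n * (c * r n) = c * (l n * r n) := by ring
          _ ≤ |c| * (l n * r n) :=
            mul_le_mul_of_nonneg_right (le_abs_self c) (mul_pos hn (hrpos n)).le
          _ ≤ _ := by gcongr
      have h6 : |‖((l n : ℂ))⁻¹ * x‖ - ‖p‖| ≤ (l n)⁻¹ * ‖x‖ + c * r n := by
        rw [← hnorm n hn]
        refine (abs_sub _ _).trans ?_
        rw [abs_norm, abs_norm]
        gcongr
      have h7 : |u n ((l n : ℂ)⁻¹ * x) - v n| ≤
          Real.pi * L * ((l n)⁻¹ * ‖x‖) + L * ((l n)⁻¹ * ‖x‖ + c * r n) + c * r n := by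
        refine (abs_sub_le _ (u n p) _).trans (add_le_add (h4.trans ?_) hpv)
        rw [hnorm n hn] at h6 ⊢
        gcongr
      rw [hf, Real.norm_eq_abs, abs_mul, abs_of_pos hn]
      calc _ ≤ l n * (Real.pi * L * ((l n)⁻¹ * ‖x‖) + L * ((l n)⁻¹ * ‖x‖ + c * r n) + c * r n) := by
            gcongr
        _ = (Real.pi * L * ‖x‖ + L * (‖x‖ + l n * (c * r n))) + l n * (c * r n) := by
            field_simp
        _ ≤ _ := by gcongr)
  refine ⟨φ, hφ, w, fun z hz => (hw' z hz).1, hw, fun δ hδ => ?_⟩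
  refine norm_fderiv_lt_of_exterior (C := Real.pi * L * r') hr'0
    (fun z hz => ⟨(hw' z hz).1, (hw' z hz).2.1⟩) (fun a z ha hz => ?_) hδ
  have haz : r' < ‖a * z‖ := by rwa [norm_mul, ha, one_mul]
  have h1 := ((hw.tendsto_at haz).sub (hw.tendsto_at (show z ∈ {z | r' < ‖z‖} from hz))).abs
  have h2 := (hr'.comp hφ.tendsto_atTop).const_mul (Real.pi * L)
  refine le_of_tendsto_of_tendsto h1 h2 (hφ.tendsto_atTop.eventually
    (p := fun n => |f n (a * z) - f n z| ≤ Real.pi * L * (l n * r n)) ?_)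
  filter_upwards [hlpos, hlR ‖z‖, hlr ‖z‖ hz] with n hn h3 h4
  have hm := hmem n hn z h4 h3
  have h5 := abs_rotation_sub_le (hrpos n) (hcont n) (hsol n) (hbdry n) ha hm.1 hm.2
  have h6 : f n (a * z) - f n z
      = l n * (u n (a * ((l n : ℂ)⁻¹ * z)) - u n ((l n : ℂ)⁻¹ * z)) := by
    simp only [hf]; rw [mul_left_comm a]; ring
  rw [h6, abs_mul, abs_of_pos hn]
  calc _ ≤ l n * (Real.pi * L * r n) := by gcongr
    _ = _ := by ring

/-- The isometric identification of `ℂ` with the Euclidean plane. -/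
def planeEquiv : ℂ ≃ₗᵢ[ℝ] EuclideanSpace ℝ (Fin 2) := Complex.orthonormalBasisOneI.repr

lemma planeEquiv_one : planeEquiv 1 = EuclideanSpace.single 0 1 := by
  simpa [planeEquiv] using Complex.orthonormalBasisOneI.repr_self 0

lemma planeEquiv_I : planeEquiv Complex.I = EuclideanSpace.single 1 1 := by
  simpa [planeEquiv] using Complex.orthonormalBasisOneI.repr_self 1

lemma fderiv_comp_planeEquiv (g : EuclideanSpace ℝ (Fin 2) → ℝ) (z w : ℂ) :
    fderiv ℝ (g ∘ planeEquiv) z w = fderiv ℝ g (planeEquiv z) (planeEquiv w) :=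
  congrArg (fun A => A w) (planeEquiv.toContinuousLinearEquiv.comp_right_fderiv (f := g) (x := z))

lemma norm_fderiv_comp_planeEquiv (g : EuclideanSpace ℝ (Fin 2) → ℝ) (z : ℂ) :
    ‖fderiv ℝ (g ∘ planeEquiv) z‖ = ‖gradient g (planeEquiv z)‖ := by
  have h : fderiv ℝ (g ∘ planeEquiv) z = _ :=
    planeEquiv.toContinuousLinearEquiv.comp_right_fderiv (f := g) (x := z)
  rw [h, gradient, LinearIsometryEquiv.norm_map]
  exact ContinuousLinearMap.opNorm_comp_linearIsometryEquiv _ planeEquiv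

lemma mseAt_comp_planeEquiv {g : EuclideanSpace ℝ (Fin 2) → ℝ} {z : ℂ}
    (hg : ContDiffAt ℝ ∞ g (planeEquiv z)) :
    MSEAt (g ∘ planeEquiv) z ↔
      (1 + (pderiv2 g 1 (planeEquiv z)) ^ 2) * pderiv2 (pderiv2 g 0) 0 (planeEquiv z)
      - 2 * pderiv2 g 0 (planeEquiv z) * pderiv2 g 1 (planeEquiv z)
        * pderiv2 (pderiv2 g 1) 0 (planeEquiv z)
      + (1 + (pderiv2 g 0 (planeEquiv z)) ^ 2) * pderiv2 (pderiv2 g 1) 1 (planeEquiv z) = 0 := by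
  have hsm : ContDiffAt ℝ ∞ (g ∘ planeEquiv) z :=
    hg.comp z planeEquiv.toContinuousLinearEquiv.contDiff.contDiffAt
  have h1 : (fun y => fderiv ℝ (g ∘ planeEquiv) y 1) = pderiv2 g 0 ∘ planeEquiv :=
    funext fun y => by rw [fderiv_comp_planeEquiv, planeEquiv_one]; rfl
  have hI : (fun y => fderiv ℝ (g ∘ planeEquiv) y Complex.I) = pderiv2 g 1 ∘ planeEquiv :=
    funext fun y => by rw [fderiv_comp_planeEquiv, planeEquiv_I]; rfl
  have h2 : ∀ v w, fderiv ℝ (fderiv ℝ (g ∘ planeEquiv)) z v w =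
      fderiv ℝ (fun y => fderiv ℝ (g ∘ planeEquiv) y w) z v := fun v w => by
    rw [(hsm.hasFDerivAt_fderiv_apply w).fderiv]; rfl
  rw [MSEAt, h2, h2, h2, h1, hI, congrFun h1 z, congrFun hI z, fderiv_comp_planeEquiv,
    fderiv_comp_planeEquiv, fderiv_comp_planeEquiv, planeEquiv_one, planeEquiv_I]
  rfl

lemma smoothMSEAt_comp_planeEquiv {g : EuclideanSpace ℝ (Fin 2) → ℝ}
    {U : Set (EuclideanSpace ℝ (Fin 2))} (hU : IsOpen U) (hg : ContDiffOn ℝ ∞ g U)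
    (hm : MinimalSurfaceEquation g U) {z : ℂ} (hz : planeEquiv z ∈ U) :
    SmoothMSEAt (g ∘ planeEquiv) z :=
  have h := hg.contDiffAt (hU.mem_nhds hz)
  ⟨h.comp z planeEquiv.toContinuousLinearEquiv.contDiff.contDiffAt,
    (mseAt_comp_planeEquiv h).2 (hm.2 _ hz)⟩

lemma SmoothMSEAt.of_comp_planeEquiv {g : EuclideanSpace ℝ (Fin 2) → ℝ}
    {U : Set (EuclideanSpace ℝ (Fin 2))}
    (h : ∀ x ∈ U, SmoothMSEAt (g ∘ planeEquiv) (planeEquiv.symm x)) :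
    ContDiffOn ℝ ∞ g U ∧ MinimalSurfaceEquation g U := by
  have hg : ∀ x ∈ U, ContDiffAt ℝ ∞ g x := fun x hx => by
    have h1 := (h x hx).1.comp x planeEquiv.symm.toContinuousLinearEquiv.contDiff.contDiffAt
    refine h1.congr_of_eventuallyEq (Eventually.of_forall fun y => ?_)
    exact (congrArg g (planeEquiv.apply_symm_apply y)).symm
  have hon : ContDiffOn ℝ ∞ g U := fun x hx => (hg x hx).contDiffWithinAt
  refine ⟨hon, hon.of_le (WithTop.coe_le_coe.2 le_top), fun x hx => ?_⟩
  have h1 := (mseAt_comp_planeEquiv (by rw [planeEquiv.apply_symm_apply]; exact hg x hx)).1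
    (h x hx).2
  rwa [planeEquiv.apply_symm_apply] at h1

lemma eucl3_dist_bounds (v w : ℝ) (p : EuclideanSpace ℝ (Fin 2)) :
    ‖p‖ ≤ dist (eucl3 0 0 v) (eucl3 (p 0) (p 1) w) ∧
      |w - v| ≤ dist (eucl3 0 0 v) (eucl3 (p 0) (p 1) w) := by
  have h : dist (eucl3 0 0 v) (eucl3 (p 0) (p 1) w) = √(p 0 ^ 2 + p 1 ^ 2 + (w - v) ^ 2) := by
    rw [EuclideanSpace.dist_eq, Fin.sum_univ_three]
    simp [eucl3, Real.dist_eq, sq_abs]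
    ring_nf
  rw [h, EuclideanSpace.norm_eq, Fin.sum_univ_two]
  simp only [Real.norm_eq_abs, sq_abs]
  exact ⟨Real.sqrt_le_sqrt (by nlinarith [sq_nonneg (w - v)]),
    Real.abs_le_sqrt (by nlinarith [sq_nonneg (p 0), sq_nonneg (p 1)])⟩

lemma exists_near_of_infDist_le {R r v c : ℝ} (hr : 0 < r) (hrR : r < R)
    {u : EuclideanSpace ℝ (Fin 2) → ℝ}
    (hv : Metric.infDist (eucl3 0 0 v)
        {x : EuclideanSpace ℝ (Fin 3) | ∃ p : EuclideanSpace ℝ (Fin 2),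
          (r ≤ ‖p‖ ∧ ‖p‖ ≤ R) ∧ x = eucl3 (p 0) (p 1) (u p)} ≤ c * r) :
    ∃ p, r ≤ ‖p‖ ∧ ‖p‖ ≤ R ∧ ‖p‖ ≤ (c + 1) * r ∧ |u p - v| ≤ (c + 1) * r := by
  have hR : 0 < R := hr.trans hrR
  have hne : {x : EuclideanSpace ℝ (Fin 3) | ∃ p : EuclideanSpace ℝ (Fin 2),
      (r ≤ ‖p‖ ∧ ‖p‖ ≤ R) ∧ x = eucl3 (p 0) (p 1) (u p)}.Nonempty :=
    ⟨_, EuclideanSpace.single 0 R, by simp [abs_of_pos hR, hrR.le], rfl⟩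
  obtain ⟨x, ⟨p, ⟨hp1, hp2⟩, rfl⟩, hd⟩ :=
    (Metric.infDist_lt_iff hne).1 (hv.trans_lt (show c * r < (c + 1) * r by nlinarith))
  obtain ⟨h1, h2⟩ := eucl3_dist_bounds v (u p) p
  exact ⟨p, hp1, hp2, h1.trans hd.le, h2.trans hd.le⟩

lemma eventually_subset_annulus {E : Type*} [NormedAddCommGroup E] {s l : ℕ → ℝ} {R r' : ℝ}
    (hR : 0 < R) (hl : Tendsto l atTop atTop) (hs : Tendsto s atTop (𝓝 r')) {K : Set E}
    (hK : IsCompact K) (hKr : K ⊆ {q | r' < ‖q‖}) :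
    ∀ᶠ n in atTop, K ⊆ {q | s n ≤ ‖q‖ ∧ ‖q‖ ≤ l n * R} := by
  rcases K.eq_empty_or_nonempty with rfl | hne
  · exact Eventually.of_forall fun n => empty_subset _
  obtain ⟨a, ha, hmin⟩ := hK.exists_isMinOn hne continuous_norm.continuousOn
  obtain ⟨b, hb, hmax⟩ := hK.exists_isMaxOn hne continuous_norm.continuousOn
  filter_upwards [hs.eventually_lt_const (hKr ha),
    (hl.atTop_mul_const hR).eventually_ge_atTop ‖b‖] with n h1 h2 q hq
  exact ⟨h1.le.trans (hmin hq), le_trans (hmax hq) h2⟩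
end

/-- Euclidean Annulus Lemma, Lemma 3.1 of the paper.  Minimal graphs `u_i`
over annuli `A(r_i, R)` with `r_i → 0`, uniformly bounded gradient, vanishing outer boundary
values, and `u_i → 0` uniformly away from the origin, rescaled by `λ_i → ∞` (with
`λ_i r_i → r' < ∞`) about points `(0,0,v_i)` at distance `O(r_i)` from the graphs, subsequentially
converge, uniformly on compact subsets of `{‖q‖ > r'}`, to a minimal graph `u'` over
`{‖q‖ > r'}` whose gradient vanishes at infinity. -/
theorem euclidean_annulus_lemma
    (R L : ℝ) (hR : 0 < R) (hL : 0 ≤ L)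
    (r : ℕ → ℝ) (hrpos : ∀ i, 0 < r i) (hrR : ∀ i, r i < R)
    (hr0 : Tendsto r atTop (nhds 0))
    (u : ℕ → EuclideanSpace ℝ (Fin 2) → ℝ)
    (hcont : ∀ i, ContinuousOn (u i)
      {p : EuclideanSpace ℝ (Fin 2) | r i ≤ ‖p‖ ∧ ‖p‖ ≤ R})
    (hsmooth : ∀ i, ContDiffOn ℝ (⊤ : ℕ∞) (u i)
      {p : EuclideanSpace ℝ (Fin 2) | r i < ‖p‖ ∧ ‖p‖ < R})
    (hmse : ∀ i, MinimalSurfaceEquation (u i)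
      {p : EuclideanSpace ℝ (Fin 2) | r i < ‖p‖ ∧ ‖p‖ < R})
    (hgrad : ∀ i, ∀ p : EuclideanSpace ℝ (Fin 2), r i < ‖p‖ → ‖p‖ < R →
      ‖gradient (u i) p‖ ≤ L)
    (hbdry : ∀ i, ∀ q : EuclideanSpace ℝ (Fin 2), ‖q‖ = R → u i q = 0)
    (hunif : ∀ η : ℝ, 0 < η → η < R →
      TendstoUniformlyOn (fun i => u i) 0 atTop
        {p : EuclideanSpace ℝ (Fin 2) | η ≤ ‖p‖ ∧ ‖p‖ ≤ R})
    (l : ℕ → ℝ) (hl : Tendsto l atTop atTop)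
    (r' : ℝ) (hr' : Tendsto (fun i => l i * r i) atTop (nhds r'))
    (v : ℕ → ℝ)
    (hv : ∃ c : ℝ, ∀ i,
      Metric.infDist (eucl3 0 0 (v i))
        {x : EuclideanSpace ℝ (Fin 3) | ∃ p : EuclideanSpace ℝ (Fin 2),
          (r i ≤ ‖p‖ ∧ ‖p‖ ≤ R) ∧ x = eucl3 (p 0) (p 1) (u i p)}
        ≤ c * r i) :
    ∃ φ : ℕ → ℕ, StrictMono φ ∧
    ∃ u' : EuclideanSpace ℝ (Fin 2) → ℝ,
      ContDiffOn ℝ (⊤ : ℕ∞) u' {q : EuclideanSpace ℝ (Fin 2) | r' < ‖q‖} ∧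
      MinimalSurfaceEquation u' {q : EuclideanSpace ℝ (Fin 2) | r' < ‖q‖} ∧
      (∀ K : Set (EuclideanSpace ℝ (Fin 2)), IsCompact K →
        K ⊆ {q : EuclideanSpace ℝ (Fin 2) | r' < ‖q‖} →
        (∀ᶠ n in atTop,
          K ⊆ {q : EuclideanSpace ℝ (Fin 2) |
            l (φ n) * r (φ n) ≤ ‖q‖ ∧ ‖q‖ ≤ l (φ n) * R}) ∧
        TendstoUniformlyOn
          (fun n q => l (φ n) * (u (φ n) ((l (φ n))⁻¹ • q) - v (φ n))) u' atTop K) ∧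
      (∀ δ : ℝ, 0 < δ → ∃ R₀ : ℝ,
        ∀ q : EuclideanSpace ℝ (Fin 2), R₀ ≤ ‖q‖ → ‖gradient u' q‖ < δ) := by
  obtain ⟨c, hc⟩ := hv
  have hopen : ∀ i, IsOpen {p : EuclideanSpace ℝ (Fin 2) | r i < ‖p‖ ∧ ‖p‖ < R} := fun i =>
    (isOpen_lt continuous_const continuous_norm).inter (isOpen_lt continuous_norm continuous_const)
  have hn : ∀ z, ‖planeEquiv z‖ = ‖z‖ := planeEquiv.norm_map
  obtain ⟨φ, hφ, w, hw, hconv, hinf⟩ := exists_subseq_rescaled_annuli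
    (u := fun i => u i ∘ planeEquiv) (v := v) (c := c + 1) hR hL hrpos
    (fun i => (hcont i).comp planeEquiv.continuous.continuousOn fun z hz => by
      simpa only [Set.mem_ofPred_eq, hn] using hz)
    (fun i z h1 h2 => by
      rw [← hn z] at h1 h2
      exact ⟨smoothMSEAt_comp_planeEquiv (hopen i) (hsmooth i) (hmse i) ⟨h1, h2⟩,
        (norm_fderiv_comp_planeEquiv _ _).trans_le (hgrad i _ h1 h2)⟩)
    (fun i z hz => hbdry i _ ((hn z).trans hz)) hl hr'
    (fun i => by
      obtain ⟨p, hp⟩ := exists_near_of_infDist_le (hrpos i) (hrR i) (hc i)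
      refine ⟨planeEquiv.symm p, ?_⟩
      rw [LinearIsometryEquiv.norm_map, Function.comp_apply, planeEquiv.apply_symm_apply]
      exact hp)
  have hsm : ∀ q, r' < ‖q‖ →
      SmoothMSEAt ((w ∘ planeEquiv.symm) ∘ planeEquiv) (planeEquiv.symm q) := fun q hq => by
    have h1 : (w ∘ planeEquiv.symm) ∘ planeEquiv = w :=
      funext fun z => congrArg w (planeEquiv.symm_apply_apply z)
    rw [h1]
    exact hw _ (by rwa [LinearIsometryEquiv.norm_map])
  obtain ⟨hs1, hs2⟩ := SmoothMSEAt.of_comp_planeEquiv (U := {q | r' < ‖q‖}) hsm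
  refine ⟨φ, hφ, w ∘ planeEquiv.symm, hs1, hs2, fun K hK hKr => ⟨?_, ?_⟩, fun δ hδ => ?_⟩
  · exact eventually_subset_annulus hR (hl.comp hφ.tendsto_atTop) (hr'.comp hφ.tendsto_atTop) hK hKr
  · have h1 := (tendstoLocallyUniformlyOn_iff_forall_isCompact
      (isOpen_lt continuous_const continuous_norm)).1 hconv (planeEquiv.symm '' K)
      (by
        rintro _ ⟨q, hq, rfl⟩
        exact (hKr hq).trans_eq (LinearIsometryEquiv.norm_map _ q).symm)
      (hK.image planeEquiv.symm.continuous)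
    refine ((h1.comp planeEquiv.symm).mono (Set.subset_preimage_image _ K)).congr
      (Eventually.of_forall fun n q _ => ?_)
    simp only [Function.comp_apply]
    rw [← Complex.ofReal_inv, ← Complex.real_smul, map_smul, planeEquiv.apply_symm_apply]
  · obtain ⟨R₀, hR₀⟩ := hinf δ hδ
    refine ⟨R₀, fun q hq => ?_⟩
    have h1 := hR₀ (planeEquiv.symm q) (by rwa [LinearIsometryEquiv.norm_map])
    have h2 := norm_fderiv_comp_planeEquiv (w ∘ planeEquiv.symm) (planeEquiv.symm q)
    have h3 : (w ∘ planeEquiv.symm) ∘ planeEquiv = w :=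
      funext fun z => congrArg w (planeEquiv.symm_apply_apply z)
    rw [h3, planeEquiv.apply_symm_apply] at h2
    rwa [← h2]
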